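/- arXiv:2405.15147 — 4 statements merged into one kernel-verified Lean document; each statement's English description precedes it below -/
import Mathlib

section
/- Let n ≥ 4 and let S be a set of four distinct vertices of the godan graph EA_n such that for every integer m with 4 ≤ m ≤ n and every i ∈ {1,…,n}, at most one vertex of S has m-th symbol equal to i (equivalently, any two distinct permutations in S differ at every position m ∈ {4,…,n}). Then there exist n − 1 pairwise internally edge disjoint S-trees in EA_n. -/
namespace Godan

/-- The transposition (12), using 0-based indices 0,1 for symbols 1,2. -/
def perm12 (n : ℕ) (hn : 3 ≤ n) : Equiv.Perm (Fin n) :=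
  Equiv.swap ⟨0, by omega⟩ ⟨1, by omega⟩

/-- The 3-cycle (123): symbol 1 ↦ 2 ↦ 3 ↦ 1, i.e. index 0 ↦ 1 ↦ 2 ↦ 0. -/
def perm123 (n : ℕ) (hn : 3 ≤ n) : Equiv.Perm (Fin n) :=
  Equiv.swap ⟨0, by omega⟩ ⟨2, by omega⟩ * Equiv.swap ⟨0, by omega⟩ ⟨1, by omega⟩

/-- The 3-cycle (132): symbol 1 ↦ 3 ↦ 2 ↦ 1, i.e. index 0 ↦ 2 ↦ 1 ↦ 0. -/
def perm132 (n : ℕ) (hn : 3 ≤ n) : Equiv.Perm (Fin n) :=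
  Equiv.swap ⟨0, by omega⟩ ⟨1, by omega⟩ * Equiv.swap ⟨0, by omega⟩ ⟨2, by omega⟩

/-- Ω* = {(12), (123), (132)} ∪ {(12)(3i) : 4 ≤ i ≤ n}; symbol i has index i - 1,
so the transposition (3i) is `Equiv.swap ⟨2,_⟩ k` with 3 ≤ k = i - 1 ≤ n - 1. -/
def OmegaStar (n : ℕ) (hn : 3 ≤ n) : Set (Equiv.Perm (Fin n)) :=
  {perm12 n hn, perm123 n hn, perm132 n hn} ∪
    {s | ∃ k : Fin n, 3 ≤ (k : ℕ) ∧ s = perm12 n hn * Equiv.swap ⟨2, by omega⟩ k}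

/-- The godan graph EA_n: vertices are the permutations of {1,…,n}, and u,v are
adjacent iff u = v ∘ s for some s ∈ Ω* (note `(v * s) i = v (s i)` in Mathlib).
Since Ω* is closed under inverses, `fromRel` yields exactly this adjacency. -/
def godanGraph (n : ℕ) (hn : 3 ≤ n) : SimpleGraph (Equiv.Perm (Fin n)) :=
  SimpleGraph.fromRel (fun u v => ∃ s ∈ OmegaStar n hn, u = v * s)

/-- `T 0, …, T (r-1)` is a family of r pairwise internally edge disjoint S-trees:
each `T i` is a subgraph of `G` which is a tree containing all vertices of `S`,
and for i ≠ j, `V(T i) ∩ V(T j) = S` and `E(T i) ∩ E(T j) = ∅`. -/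
def IsIDSTFamily {V : Type*} (G : SimpleGraph V) (S : Set V) {r : ℕ}
    (T : Fin r → G.Subgraph) : Prop :=
  (∀ i, S ⊆ (T i).verts ∧ ((T i).coe).IsTree) ∧
    ∀ i j, i ≠ j → (T i).verts ∩ (T j).verts = S ∧ (T i).edgeSet ∩ (T j).edgeSet = ∅

/-- The maximum number of pairwise internally edge disjoint S-trees in G. -/
noncomputable def maxIDST {V : Type*} (G : SimpleGraph V) (S : Set V) : ℕ :=
  sSup {r : ℕ | ∃ T : Fin r → G.Subgraph, IsIDSTFamily G S T}

/-- The generalized k-connectivity κ_k(G): the minimum over all k-element vertex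
sets S of the maximum number of pairwise internally edge disjoint S-trees. -/
noncomputable def genConn {V : Type*} [Fintype V] (G : SimpleGraph V) (k : ℕ) : ℕ :=
  sInf {m : ℕ | ∃ S : Finset V, S.card = k ∧ maxIDST G (↑S : Set V) = m}

section Trees

variable {V : Type*}

/-- A vertex set in which every vertex is joined to a fixed root inside `H` spans a subtree
of `G`. -/
theorem exists_isTree_subgraph {G H : SimpleGraph V} (hH : H ≤ G) {W : Set V} {r : V}
    (hr : r ∈ W)
    (hconn : ∀ v ∈ W, Relation.ReflTransGen (fun a b => H.Adj a b ∧ a ∈ W ∧ b ∈ W) r v) :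
    ∃ T : G.Subgraph, T.verts = W ∧ T.coe.IsTree ∧ ∀ u v, T.Adj u v → H.Adj u v := by
  have hreach : ∀ v (hv : v ∈ W), (H.induce W).Reachable ⟨r, hr⟩ ⟨v, hv⟩ := by
    intro v hv
    have key : ∀ v, Relation.ReflTransGen (fun a b => H.Adj a b ∧ a ∈ W ∧ b ∈ W) r v →
        ∃ hv : v ∈ W, (H.induce W).Reachable ⟨r, hr⟩ ⟨v, hv⟩ := by
      intro v h
      induction h with
      | refl => exact ⟨hr, SimpleGraph.Reachable.refl _⟩
      | tail _ hbc ih =>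
        obtain ⟨hb, hrb⟩ := ih
        refine ⟨hbc.2.2, hrb.trans (SimpleGraph.Adj.reachable ?_)⟩
        simpa using hbc.1
    exact (key v (hconn v hv)).2
  have hc : (H.induce W).Connected := by
    have : Nonempty W := ⟨⟨r, hr⟩⟩
    refine ⟨fun u v => (hreach u.1 u.2).symm.trans (hreach v.1 v.2)⟩
  obtain ⟨T, hle, hT⟩ := hc.exists_isTree_le
  refine ⟨{ verts := W
            Adj := fun u v => ∃ (hu : u ∈ W) (hv : v ∈ W), T.Adj ⟨u, hu⟩ ⟨v, hv⟩
            adj_sub := ?_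
            edge_vert := fun h => h.1
            symm := ⟨fun u v ⟨hu, hv, h⟩ => ⟨hv, hu, h.symm⟩⟩ }, rfl, ?_, ?_⟩
  · rintro u v ⟨hu, hv, h⟩
    exact hH (by simpa using hle h)
  · convert hT using 1
    ext u v
    simp only [SimpleGraph.Subgraph.coe_adj]
    exact ⟨fun ⟨_, _, h⟩ => h, fun h => ⟨u.2, v.2, h⟩⟩
  · rintro u v ⟨hu, hv, h⟩
    simpa using hle h

/-- Connected subgraphs with vertex sets meeting exactly in `S`, and without common edge inside
`S`, yield internally edge disjoint `S`-trees. -/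
theorem exists_isIDSTFamily {G : SimpleGraph V} {S : Set V} {r : ℕ} (H : Fin r → SimpleGraph V)
    (W : Fin r → Set V) (root : Fin r → V) (hH : ∀ i, H i ≤ G) (hS : ∀ i, S ⊆ W i)
    (hW : ∀ i j, i ≠ j → W i ∩ W j ⊆ S)
    (hdisj : ∀ i j, i ≠ j → ∀ u ∈ S, ∀ v ∈ S, (H i).Adj u v → ¬ (H j).Adj u v)
    (hroot : ∀ i, root i ∈ W i)
    (hconn : ∀ i, ∀ v ∈ W i,
      Relation.ReflTransGen (fun a b => (H i).Adj a b ∧ a ∈ W i ∧ b ∈ W i) (root i) v) :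
    ∃ T : Fin r → G.Subgraph, IsIDSTFamily G S T := by
  choose T hT using fun i => exists_isTree_subgraph (hH i) (hroot i) (hconn i)
  refine ⟨T, fun i => ⟨(hT i).1 ▸ hS i, (hT i).2.1⟩, fun i j hij => ⟨?_, ?_⟩⟩
  · rw [(hT i).1, (hT j).1]
    exact (hW i j hij).antisymm (Set.subset_inter (hS i) (hS j))
  · rw [Set.eq_empty_iff_forall_notMem]
    intro e
    induction e using Sym2.ind with
    | _ u v =>
      rintro ⟨hi, hj⟩
      rw [SimpleGraph.Subgraph.mem_edgeSet] at hi hj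
      have hu : u ∈ S := hW i j hij ⟨(hT i).1 ▸ hi.fst_mem, (hT j).1 ▸ hj.fst_mem⟩
      have hv : v ∈ S := hW i j hij ⟨(hT i).1 ▸ hi.snd_mem, (hT j).1 ▸ hj.snd_mem⟩
      exact hdisj i j hij u hu v hv ((hT i).2.2 u v hi) ((hT j).2.2 u v hj)

/-- Pairwise disjoint connected sets avoiding `S`, each adjacent to every vertex of `S`, yield
internally edge disjoint `S`-trees. -/
theorem exists_isIDSTFamily_of_connectors {G : SimpleGraph V} {S : Set V} {r : ℕ}
    (D : Fin r → Set V) (root : Fin r → V) (hDS : ∀ i, ∀ v ∈ D i, v ∉ S)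
    (hD : ∀ i j, i ≠ j → ∀ v ∈ D i, v ∉ D j)
    (hroot : ∀ i, root i ∈ D i)
    (hconn : ∀ i, ∀ v ∈ D i,
      Relation.ReflTransGen (fun a b => G.Adj a b ∧ a ∈ D i ∧ b ∈ D i) (root i) v)
    (hadj : ∀ i, ∀ x ∈ S, ∃ v ∈ D i, G.Adj x v) :
    ∃ T : Fin r → G.Subgraph, IsIDSTFamily G S T := by
  let H : SimpleGraph V :=
    { Adj := fun u v => G.Adj u v ∧ ¬ (u ∈ S ∧ v ∈ S)
      symm := ⟨fun u v h => ⟨h.1.symm, fun h' => h.2 ⟨h'.2, h'.1⟩⟩⟩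
      loopless := ⟨fun u h => G.loopless.irrefl u h.1⟩ }
  refine exists_isIDSTFamily (fun _ => H) (fun i => D i ∪ S) root (fun _ _ _ h => h.1)
    (fun i => Set.subset_union_right) ?_ (fun i j _ u hu v hv h => absurd ⟨hu, hv⟩ h.2)
    (fun i => Or.inl (hroot i)) ?_
  · rintro i j hij v ⟨hi | hi, hj | hj⟩
    · exact absurd hj (hD i j hij v hi)
    all_goals assumption
  · have hlift : ∀ i, ∀ v ∈ D i, Relation.ReflTransGen
        (fun a b => H.Adj a b ∧ a ∈ D i ∪ S ∧ b ∈ D i ∪ S) (root i) v := by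
      intro i v hv
      refine Relation.ReflTransGen.mono ?_ _ _ (hconn i v hv)
      rintro a b ⟨hab, ha, hb⟩
      exact ⟨⟨hab, fun h => hDS i a ha h.1⟩, Or.inl ha, Or.inl hb⟩
    rintro i v (hv | hv)
    · exact hlift i v hv
    · obtain ⟨w, hw, hvw⟩ := hadj i v hv
      exact (hlift i w hw).tail ⟨⟨hvw.symm, fun h => hDS i w hw h.1⟩, Or.inl hw, Or.inr hv⟩

end Trees

section Generators

variable {n : ℕ}

/-- The generators of the godan graph in a uniform way: `gen a = (0 1)(2 a)` for `a < n`, so that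
`gen 2 = (0 1)`, the values `a = 0, 1` give the two 3-cycles, and `gen a = 1` for `n ≤ a`. -/
def gen (hn : 3 ≤ n) (a : ℕ) : Equiv.Perm (Fin n) :=
  if h : a < n then perm12 n hn * Equiv.swap ⟨2, by omega⟩ ⟨a, h⟩ else 1

theorem gen_of_lt (hn : 3 ≤ n) {a : ℕ} (h : a < n) :
    gen hn a = perm12 n hn * Equiv.swap ⟨2, by omega⟩ ⟨a, h⟩ := dif_pos h

theorem gen_of_le (hn : 3 ≤ n) {a : ℕ} (h : n ≤ a) : gen hn a = 1 := dif_neg (by omega)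

theorem gen_two (hn : 3 ≤ n) : gen hn 2 = perm12 n hn := by
  rw [gen_of_lt hn (by omega), Equiv.swap_self]; rfl

theorem gen_zero (hn : 3 ≤ n) : gen hn 0 = perm132 n hn := by
  rw [gen_of_lt hn (by omega), perm12, perm132, Equiv.swap_comm (⟨2, by omega⟩ : Fin n)]

theorem gen_one (hn : 3 ≤ n) : gen hn 1 = perm123 n hn := by
  rw [gen_of_lt hn (by omega), perm12, perm123]
  have h01 : (⟨0, by omega⟩ : Fin n) ≠ ⟨1, by omega⟩ := by simp
  have h02 : (⟨0, by omega⟩ : Fin n) ≠ ⟨2, by omega⟩ := by simp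
  rw [Equiv.mul_swap_eq_swap_mul]
  rw [Equiv.swap_apply_right, Equiv.swap_apply_of_ne_of_ne h02.symm (by simp), Equiv.swap_comm]

/-- `gen a` as a map on the values of indices. -/
theorem gen_apply_val (hn : 3 ≤ n) {a : ℕ} (ha : a < n) (i : Fin n) :
    ((gen hn a i : Fin n) : ℕ) =
      if (i : ℕ) = 2 then if a = 0 then 1 else if a = 1 then 0 else a
      else if (i : ℕ) = a then 2
      else if (i : ℕ) = 0 then 1 else if (i : ℕ) = 1 then 0 else i := by
  rw [gen_of_lt hn ha, perm12, Equiv.Perm.mul_apply]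
  simp only [Equiv.swap_apply_def, Fin.ext_iff]
  grind

theorem gen_apply_of_ne (hn : 3 ≤ n) {a : ℕ} {i : Fin n} (hi : 3 ≤ (i : ℕ)) (hia : (i : ℕ) ≠ a) :
    gen hn a i = i := by
  rcases lt_or_ge a n with ha | ha
  · apply Fin.ext
    rw [gen_apply_val hn ha]
    grind
  · rw [gen_of_le hn ha]; rfl

theorem gen_apply_self (hn : 3 ≤ n) {i : Fin n} (hi : 3 ≤ (i : ℕ)) :
    gen hn i i = ⟨2, by omega⟩ := by
  apply Fin.ext
  rw [gen_apply_val hn i.2]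
  grind

theorem gen_apply_two (hn : 3 ≤ n) {i : Fin n} (hi : 3 ≤ (i : ℕ)) :
    gen hn i ⟨2, by omega⟩ = i := by
  apply Fin.ext
  rw [gen_apply_val hn i.2]
  grind

theorem gen_mul_self (hn : 3 ≤ n) {a : ℕ} (ha : 2 ≤ a) : gen hn a * gen hn a = 1 := by
  rcases lt_or_ge a n with han | han
  · ext i
    rw [Equiv.Perm.mul_apply, gen_apply_val hn han, gen_apply_val hn han]
    rw [Equiv.Perm.one_apply]
    grind
  · rw [gen_of_le hn han, one_mul]

theorem gen_zero_mul_gen_one (hn : 3 ≤ n) : gen hn 0 * gen hn 1 = 1 := by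
  ext i
  rw [Equiv.Perm.mul_apply, gen_apply_val hn (by omega), gen_apply_val hn (by omega)]
  rw [Equiv.Perm.one_apply]
  grind

theorem gen_ne_one (hn : 3 ≤ n) {a : ℕ} (ha : a < n) : gen hn a ≠ 1 := by
  intro h
  have := gen_apply_val hn ha ⟨1, by omega⟩
  rw [h] at this
  rw [Equiv.Perm.one_apply] at this
  grind

theorem sign_perm12 (hn : 3 ≤ n) : Equiv.Perm.sign (perm12 n hn) = -1 :=
  Equiv.Perm.sign_swap (by simp)

theorem sign_gen (hn : 3 ≤ n) {a : ℕ} (ha : a ≠ 2) : Equiv.Perm.sign (gen hn a) = 1 := by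
  rcases lt_or_ge a n with han | han
  · rw [gen_of_lt hn han, Equiv.Perm.sign_mul, sign_perm12, Equiv.Perm.sign_swap]
    · rfl
    · simpa using ha.symm
  · rw [gen_of_le hn han, Equiv.Perm.sign_one]

theorem gen_mem_omegaStar (hn : 3 ≤ n) {a : ℕ} (ha : a < n) : gen hn a ∈ OmegaStar n hn := by
  rcases lt_or_ge a 3 with h | h
  · left
    interval_cases a
    · rw [gen_zero]; simp
    · rw [gen_one]; simp
    · rw [gen_two]; simp
  · exact Or.inr ⟨⟨a, ha⟩, h, gen_of_lt hn ha⟩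

theorem adj_mul_gen (hn : 3 ≤ n) {a : ℕ} (ha : a < n) (v : Equiv.Perm (Fin n)) :
    (godanGraph n hn).Adj v (v * gen hn a) := by
  rw [godanGraph, SimpleGraph.fromRel_adj]
  refine ⟨?_, Or.inr ⟨_, gen_mem_omegaStar hn ha, rfl⟩⟩
  intro h
  exact gen_ne_one hn ha (by simpa using h.symm)

/-- The even permutations fixing `m` are generated by the generators fixing `m`. -/
theorem mem_closure_gen (hn : 3 ≤ n) {m : Fin n} {σ : Equiv.Perm (Fin n)}
    (hσm : σ m = m) (hσ : Equiv.Perm.sign σ = 1) :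
    σ ∈ Subgroup.closure {s | ∃ a : ℕ, a < n ∧ a ≠ 2 ∧ a ≠ m ∧ s = gen hn a} := by
  set Γ : Set (Equiv.Perm (Fin n)) := {s | ∃ a : ℕ, a < n ∧ a ≠ 2 ∧ a ≠ m ∧ s = gen hn a}
  set K := Subgroup.closure Γ
  set t := perm12 n hn with ht
  have htt : t * t = 1 := Equiv.swap_mul_self _ _
  have ht1 : t⁻¹ = t := inv_eq_of_mul_eq_one_left htt
  let two : Fin n := ⟨2, by omega⟩
  let Δ : Set (Equiv.Perm (Fin n)) := {s | ∃ a : Fin n, a ≠ two ∧ a ≠ m ∧ s = Equiv.swap two a}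
  have hconj : ∀ s ∈ K, t * s * t ∈ K := by
    intro s hs
    induction hs using Subgroup.closure_induction with
    | mem s hs =>
      obtain ⟨a, ha, ha2, ham, rfl⟩ := hs
      have : t * gen hn a * t = (gen hn a)⁻¹ := by
        rw [gen_of_lt hn ha, ← ht, mul_inv_rev, ht1, Equiv.swap_inv, ← mul_assoc, htt, one_mul]
      rw [this]
      exact K.inv_mem (Subgroup.subset_closure ⟨a, ha, ha2, ham, rfl⟩)
    | one => rw [mul_one, htt]; exact K.one_mem
    | mul x y _ _ hx hy =>
      have : t * (x * y) * t = (t * x * t) * (t * y * t) := by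
        calc t * (x * y) * t = t * x * 1 * y * t := by group
          _ = _ := by rw [← htt]; group
      rw [this]; exact K.mul_mem hx hy
    | inv x _ hx =>
      have : t * x⁻¹ * t = (t * x * t)⁻¹ := by
        rw [mul_inv_rev, mul_inv_rev, ht1, mul_assoc]
      rw [this]; exact K.inv_mem hx
  have hcases : ∀ s ∈ Subgroup.closure Δ, s ∈ K ∨ t * s ∈ K := by
    intro s hs
    induction hs using Subgroup.closure_induction with
    | mem s hs =>
      obtain ⟨a, ha2, ham, rfl⟩ := hs
      right
      refine Subgroup.subset_closure ⟨a, a.2, fun h => ha2 (Fin.ext h), fun h => ham (Fin.ext h), ?_⟩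
      rw [gen_of_lt hn a.2]
    | one => exact Or.inl K.one_mem
    | mul x y _ _ hx hy =>
      rcases hx with hx | hx <;> rcases hy with hy | hy
      · exact Or.inl (K.mul_mem hx hy)
      · right
        have : t * (x * y) = (t * x * t) * (t * y) := by
          rw [mul_assoc (t * x), ← mul_assoc t t y, htt, one_mul, mul_assoc]
        rw [this]; exact K.mul_mem (hconj x hx) hy
      · right
        rw [← mul_assoc]; exact K.mul_mem hx hy
      · left
        have : x * y = (t * (t * x) * t) * (t * y) := by
          rw [← mul_assoc t t x, htt, one_mul, mul_assoc x, ← mul_assoc t t y, htt, one_mul]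
        rw [this]; exact K.mul_mem (hconj _ hx) hy
    | inv x _ hx =>
      rcases hx with hx | hx
      · exact Or.inl (K.inv_mem hx)
      · right
        have : t * x⁻¹ = t * (t * x)⁻¹ * t := by
          rw [mul_inv_rev, ht1, mul_assoc, mul_assoc, htt, mul_one]
        rw [this]; exact hconj _ (K.inv_mem hx)
  have hsub : ∀ s ∈ K, Equiv.Perm.sign s = 1 := by
    intro s hs
    have : K ≤ (Equiv.Perm.sign (α := Fin n)).ker := by
      rw [Subgroup.closure_le]
      rintro _ ⟨a, -, ha2, -, rfl⟩
      exact sign_gen hn ha2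
    exact this hs
  have hmem : σ ∈ Subgroup.closure Δ := by
    rw [mem_closure_isSwap]
    · refine ⟨Set.toFinite _, fun x => ?_⟩
      have horb : ∀ y, y ≠ m → two ∈ MulAction.orbit (Subgroup.closure Δ) y := by
        intro y hy
        by_cases hy2 : y = two
        · rw [hy2]; exact MulAction.mem_orbit_self _
        · exact ⟨⟨Equiv.swap two y, Subgroup.subset_closure ⟨y, hy2, hy, rfl⟩⟩,
            Equiv.swap_apply_right two y⟩
      by_cases hx : x = m
      · rw [hx, hσm]; exact MulAction.mem_orbit_self _
      · have hσx : σ x ≠ m := fun h => hx (σ.injective (h.trans hσm.symm))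
        have h1 := MulAction.orbit_eq_iff.mpr (horb x hx)
        have h2 := MulAction.orbit_eq_iff.mpr (horb _ hσx)
        rw [← h1, h2]
        exact MulAction.mem_orbit_self _
    · rintro _ ⟨a, ha2, -, rfl⟩
      exact ⟨two, a, ha2.symm, rfl⟩
  rcases hcases σ hmem with h | h
  · exact h
  · have := hsub _ h
    rw [Equiv.Perm.sign_mul, hσ, sign_perm12] at this
    exact absurd this (by decide)

end Generators

section Labelling

variable {n : ℕ}

/-- The symbols of distinct vertices of `S` differ at every position from the fourth on. -/
def Separated (S : Set (Equiv.Perm (Fin n))) : Prop :=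
  ∀ x ∈ S, ∀ y ∈ S, ∀ k : Fin n, 3 ≤ (k : ℕ) → x k = y k → x = y

/-- `m` and `c` do not conflict at `x`, `y`: an edge labelled `m` joins two vertices at distance at
most one from `x` and `y` along generators fixing `m` only if one of them is a proper neighbour
with third symbol `c`. -/
def NoConflict (hn : 3 ≤ n) (m c : Fin n) (x y : Equiv.Perm (Fin n)) : Prop :=
  ∀ a b : ℕ, a ≠ 2 → a ≠ m → b ≠ 2 → b ≠ m → x * gen hn a * gen hn m = y * gen hn b →
    (a < n ∧ (x * gen hn a) ⟨2, by omega⟩ = c) ∨ (b < n ∧ (y * gen hn b) ⟨2, by omega⟩ = c)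

theorem mul_gen_mul_gen_apply (hn : 3 ≤ n) {m : Fin n} (hm : 3 ≤ (m : ℕ))
    (x : Equiv.Perm (Fin n)) : (x * gen hn m) m = x ⟨2, by omega⟩ := by
  rw [Equiv.Perm.mul_apply, gen_apply_self hn hm]

theorem mul_gen_apply (hn : 3 ≤ n) {k : Fin n} (hk : 3 ≤ (k : ℕ)) {a : ℕ} (ha : a ≠ k)
    (x : Equiv.Perm (Fin n)) : (x * gen hn a) k = x k := by
  rw [Equiv.Perm.mul_apply, gen_apply_of_ne hn hk (fun h => ha h.symm)]

theorem mul_gen_gen_ne (hn : 3 ≤ n) {m : Fin n} (hm : 3 ≤ (m : ℕ)) (x : Equiv.Perm (Fin n))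
    {a b : ℕ} (ha : a ≠ m) (hb : b ≠ m) : x * gen hn a * gen hn m ≠ x * gen hn b := by
  intro h
  have h1 := congrArg (fun s : Equiv.Perm (Fin n) => s m) h
  simp only [mul_gen_mul_gen_apply hn hm, mul_gen_apply hn hm hb] at h1
  rw [← mul_gen_apply hn hm ha x] at h1
  have := congrArg Fin.val ((x * gen hn a).injective h1)
  simp only at this
  omega

/-- The neighbours of `S` along generators fixing `m`. -/
def nearSet (hn : 3 ≤ n) (S : Set (Equiv.Perm (Fin n))) (m : Fin n) :
    Set (Equiv.Perm (Fin n)) :=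
  {v | ∃ x ∈ S, ∃ a : ℕ, a < n ∧ a ≠ 2 ∧ a ≠ m ∧ v = x * gen hn a}

open Classical in
/-- Vertices are labelled by their symbol at `m`, except that neighbours of `S` along generators
fixing `m` are labelled by their third symbol, unless it is the discarded symbol `c₀`. -/
noncomputable def label (hn : 3 ≤ n) (S : Set (Equiv.Perm (Fin n))) (m c₀ : Fin n)
    (v : Equiv.Perm (Fin n)) : Fin n :=
  if v ∈ nearSet hn S m ∧ v ⟨2, by omega⟩ ≠ c₀ then v ⟨2, by omega⟩ else v m

/-- The vertices outside `S` with label `c`. -/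
def connector (hn : 3 ≤ n) (S : Set (Equiv.Perm (Fin n))) (m c₀ c : Fin n) :
    Set (Equiv.Perm (Fin n)) :=
  {v | v ∉ S ∧ label hn S m c₀ v = c}

theorem mul_gen_notMem (hn : 3 ≤ n) {S : Set (Equiv.Perm (Fin n))} (hS : Separated S)
    {m : Fin n} (hm : 3 ≤ (m : ℕ)) {x : Equiv.Perm (Fin n)} (hx : x ∈ S) {a : ℕ} (ha : a < n)
    (ham : a ≠ m) : x * gen hn a ∉ S := by
  intro h
  have := hS _ h x hx m hm (mul_gen_apply hn hm ham x)
  exact gen_ne_one hn ha (by simpa using this)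

theorem mul_gen_mul_gen_mem_connector (hn : 3 ≤ n) {S : Set (Equiv.Perm (Fin n))}
    {m c₀ : Fin n} (hm : 3 ≤ (m : ℕ))
    (hc : ∀ x ∈ S, ∀ y ∈ S, x ≠ y → NoConflict hn m c₀ x y) {x : Equiv.Perm (Fin n)} (hx : x ∈ S)
    {a : ℕ} (ha : a ≠ 2) (ham : a ≠ m)
    (hac : a < n → (x * gen hn a) ⟨2, by omega⟩ ≠ c₀) :
    x * gen hn a * gen hn m ∈ connector hn S m c₀ ((x * gen hn a) ⟨2, by omega⟩) ∧
      ¬ (x * gen hn a * gen hn m ∈ nearSet hn S m ∧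
        (x * gen hn a * gen hn m) ⟨2, by omega⟩ ≠ c₀) := by
  have hc' : ∀ x ∈ S, ∀ y ∈ S, NoConflict hn m c₀ x y := by
    intro x hx y hy
    by_cases hxy : x = y
    · subst hxy
      intro a b _ ham _ hbm h
      exact absurd h (mul_gen_gen_ne hn hm x ham hbm)
    · exact hc x hx y hy hxy
  have h2 : ¬ (x * gen hn a * gen hn m ∈ nearSet hn S m ∧
      (x * gen hn a * gen hn m) ⟨2, by omega⟩ ≠ c₀) := by
    rintro ⟨⟨y, hy, b, hb, hb2, hbm, h⟩, h'⟩
    rcases hc' x hx y hy a b ha ham hb2 hbm h with h1 | h1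
    · exact hac h1.1 h1.2
    · rw [h] at h'; exact h' h1.2
  refine ⟨⟨fun h => ?_, ?_⟩, h2⟩
  · have hnn : n ≠ 2 := by omega
    have hnm : n ≠ m := m.2.ne'
    rcases hc' x hx _ h a n ha ham hnn hnm (by rw [gen_of_le hn le_rfl, mul_one]) with h1 | h1
    · exact hac h1.1 h1.2
    · exact absurd h1.1 (lt_irrefl n)
  · rw [label, if_neg h2, mul_gen_mul_gen_apply hn hm]

theorem exists_mem_connector_adj (hn : 3 ≤ n) {S : Set (Equiv.Perm (Fin n))} (hS : Separated S)
    {m c₀ c : Fin n} (hm : 3 ≤ (m : ℕ))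
    (hconf : ∀ x ∈ S, ∀ y ∈ S, x ≠ y → NoConflict hn m c₀ x y) (hc : c ≠ c₀)
    {x : Equiv.Perm (Fin n)} (hx : x ∈ S) :
    ∃ v ∈ connector hn S m c₀ c, (godanGraph n hn).Adj x v := by
  obtain ⟨j, rfl⟩ := x.surjective c
  have hnear : ∀ a : ℕ, a < n → a ≠ 2 → a ≠ m → gen hn a ⟨2, by omega⟩ = j →
      ∃ v ∈ connector hn S m c₀ (x j), (godanGraph n hn).Adj x v := by
    intro a ha ha2 ham haj
    refine ⟨x * gen hn a, ⟨mul_gen_notMem hn hS hm hx ha ham, ?_⟩, adj_mul_gen hn ha x⟩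
    have h : (x * gen hn a) ⟨2, by omega⟩ = x j := by rw [Equiv.Perm.mul_apply, haj]
    rw [label, if_pos ⟨⟨x, hx, a, ha, ha2, ham, rfl⟩, h ▸ hc⟩, h]
  by_cases hjm : j = m
  · subst hjm
    refine ⟨x * gen hn 2, ⟨mul_gen_notMem hn hS hm hx (by omega) (by omega), ?_⟩,
      adj_mul_gen hn (by omega) x⟩
    rw [label, if_neg, mul_gen_apply hn hm (by omega)]
    rintro ⟨⟨y, hy, a, -, ha2, ham, h⟩, -⟩
    have hxy : x = y := by
      refine hS x hx y hy j hm ?_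
      have := congrArg (fun s : Equiv.Perm (Fin n) => s j) h
      simpa only [mul_gen_apply hn hm (show 2 ≠ (j : ℕ) by omega), mul_gen_apply hn hm ham] using this
    subst hxy
    have h' := congrArg Equiv.Perm.sign (mul_left_cancel h)
    rw [gen_two, sign_perm12, sign_gen hn ha2] at h'
    exact absurd h' (by decide)
  by_cases hj2 : (j : ℕ) = 2
  · have hj : j = ⟨2, by omega⟩ := Fin.ext hj2
    have hnn : n ≠ 2 := by omega
    have hnm : n ≠ m := m.2.ne'
    have := (mul_gen_mul_gen_mem_connector hn hm hconf hx hnn hnm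
      (fun h => absurd h (lt_irrefl n))).1
    rw [gen_of_le hn le_rfl, mul_one, ← hj] at this
    exact ⟨_, this, adj_mul_gen hn m.2 x⟩
  rcases lt_or_ge (j : ℕ) 3 with hj3 | hj3
  · have h01 : (j : ℕ) = 0 ∨ (j : ℕ) = 1 := by omega
    rcases h01 with h | h
    · refine hnear 1 (by omega) (by omega) (by omega) (Fin.ext ?_)
      rw [gen_apply_val hn (by omega)]; simp [h]
    · refine hnear 0 (by omega) (by omega) (by omega) (Fin.ext ?_)
      rw [gen_apply_val hn (by omega)]; simp [h]
  · exact hnear j j.2 hj2 (fun h => hjm (Fin.ext h)) (gen_apply_two hn hj3)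

theorem exists_root_connector (hn : 3 ≤ n) {S : Set (Equiv.Perm (Fin n))} (hS : Separated S)
    {m c₀ c : Fin n} (hm : 3 ≤ (m : ℕ))
    (hconf : ∀ x ∈ S, ∀ y ∈ S, x ≠ y → NoConflict hn m c₀ x y) :
    ∃ r ∈ connector hn S m c₀ c, ∀ v ∈ connector hn S m c₀ c,
      Relation.ReflTransGen (fun a b => (godanGraph n hn).Adj a b ∧ a ∈ connector hn S m c₀ c ∧
        b ∈ connector hn S m c₀ c) r v := by
  set D := connector hn S m c₀ c with hD
  set R := fun a b => (godanGraph n hn).Adj a b ∧ a ∈ D ∧ b ∈ D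
  have hsymm : ∀ a b, Relation.ReflTransGen R a b → Relation.ReflTransGen R b a := by
    intro a b h
    have : Std.Symm R := ⟨fun _ _ h => ⟨h.1.symm, h.2.2, h.2.1⟩⟩
    exact symm h
  obtain ⟨ε, hε⟩ : ∃ ε : ℤˣ, ∀ x ∈ S, x m = c → Equiv.Perm.sign x ≠ ε := by
    by_cases h : ∃ x ∈ S, x m = c
    · obtain ⟨x, hx, hxc⟩ := h
      refine ⟨-Equiv.Perm.sign x, fun y hy hyc => ?_⟩
      rw [hS y hy x hx m hm (hyc.trans hxc.symm)]
      rcases Int.units_eq_one_or (Equiv.Perm.sign x) with h | h <;> rw [h] <;> decide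
    · exact ⟨1, fun x hx hxc => absurd ⟨x, hx, hxc⟩ h⟩
  have hcore : ∀ v : Equiv.Perm (Fin n), v m = c → Equiv.Perm.sign v = ε → v ∈ D := by
    intro v hv hs
    refine ⟨fun h => hε v h hv hs, ?_⟩
    rw [label, if_neg, hv]
    rintro ⟨⟨x, hx, a, -, ha2, ham, rfl⟩, -⟩
    rw [mul_gen_apply hn hm ham] at hv
    rw [Equiv.Perm.sign_mul, sign_gen hn ha2, mul_one] at hs
    exact hε x hx hv hs
  have hpath : ∀ s ∈ Subgroup.closure {s | ∃ a : ℕ, a < n ∧ a ≠ 2 ∧ a ≠ m ∧ s = gen hn a},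
      s m = m ∧ Equiv.Perm.sign s = 1 ∧ ∀ u : Equiv.Perm (Fin n), u m = c →
        Equiv.Perm.sign u = ε → Relation.ReflTransGen R u (u * s) := by
    intro s hs
    induction hs using Subgroup.closure_induction with
    | mem s hs =>
      obtain ⟨a, ha, ha2, ham, rfl⟩ := hs
      have hfix := gen_apply_of_ne hn hm (Ne.symm ham)
      refine ⟨hfix, sign_gen hn ha2, fun u hu hsu => Relation.ReflTransGen.single
        ⟨adj_mul_gen hn ha u, hcore u hu hsu, hcore _ ?_ ?_⟩⟩
      · rw [Equiv.Perm.mul_apply, hfix, hu]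
      · rw [Equiv.Perm.sign_mul, sign_gen hn ha2, mul_one, hsu]
    | one =>
      refine ⟨rfl, Equiv.Perm.sign_one, fun u _ _ => ?_⟩
      rw [mul_one]
    | mul x y _ _ hx hy =>
      refine ⟨by rw [Equiv.Perm.mul_apply, hy.1, hx.1],
        by rw [Equiv.Perm.sign_mul, hx.2.1, hy.2.1, one_mul], fun u hu hsu => ?_⟩
      rw [← mul_assoc]
      refine (hx.2.2 u hu hsu).trans (hy.2.2 _ ?_ ?_)
      · rw [Equiv.Perm.mul_apply, hx.1, hu]
      · rw [Equiv.Perm.sign_mul, hx.2.1, hsu, mul_one]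
    | inv x _ hx =>
      have hfix : x⁻¹ m = m := by rw [Equiv.Perm.inv_eq_iff_eq, hx.1]
      have hsgn : Equiv.Perm.sign x⁻¹ = 1 := by rw [Equiv.Perm.sign_inv, hx.2.1]
      refine ⟨hfix, hsgn, fun u hu hsu => hsymm _ _ ?_⟩
      have := hx.2.2 (u * x⁻¹) (by rw [Equiv.Perm.mul_apply, hfix, hu])
        (by rw [Equiv.Perm.sign_mul, hsgn, hsu, mul_one])
      rwa [inv_mul_cancel_right] at this
  have htau : ∀ v : Equiv.Perm (Fin n), (v * gen hn 2) m = v m ∧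
      Equiv.Perm.sign (v * gen hn 2) = -Equiv.Perm.sign v := by
    intro v
    refine ⟨mul_gen_apply hn hm (by omega) v, ?_⟩
    rw [Equiv.Perm.sign_mul, gen_two, sign_perm12, mul_neg, mul_one]
  have hflip : ∀ v : Equiv.Perm (Fin n), Equiv.Perm.sign v ≠ ε →
      Equiv.Perm.sign (v * gen hn 2) = ε := by
    intro v hv
    rw [(htau v).2]
    rcases Int.units_eq_one_or (Equiv.Perm.sign v) with h | h <;>
      rcases Int.units_eq_one_or ε with h' | h' <;> simp_all
  obtain ⟨r, hrm, hrs⟩ : ∃ r : Equiv.Perm (Fin n), r m = c ∧ Equiv.Perm.sign r = ε := by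
    by_cases h : Equiv.Perm.sign (Equiv.swap m c) = ε
    · exact ⟨_, Equiv.swap_apply_left m c, h⟩
    · exact ⟨_, (htau _).1.trans (Equiv.swap_apply_left m c), hflip _ h⟩
  have hreach : ∀ v : Equiv.Perm (Fin n), v m = c → Equiv.Perm.sign v = ε →
      Relation.ReflTransGen R r v := by
    intro v hv hs
    have := (hpath (r⁻¹ * v) (mem_closure_gen hn ?_ ?_)).2.2 r hrm hrs
    · rwa [mul_inv_cancel_left] at this
    · rw [Equiv.Perm.mul_apply, hv, Equiv.Perm.inv_eq_iff_eq, hrm]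
    · rw [Equiv.Perm.sign_mul, Equiv.Perm.sign_inv, hrs, hs, Int.units_mul_self]
  have hreach' : ∀ v ∈ D, v m = c → Relation.ReflTransGen R r v := by
    intro v hvD hv
    by_cases hs : Equiv.Perm.sign v = ε
    · exact hreach v hv hs
    · have h1 := (htau v).1.trans hv
      have h2 := hflip v hs
      exact (hreach _ h1 h2).tail ⟨(adj_mul_gen hn (by omega) v).symm, hcore _ h1 h2, hvD⟩
  refine ⟨r, hcore r hrm hrs, fun v hv => ?_⟩
  by_cases hnear : v ∈ nearSet hn S m ∧ v ⟨2, by omega⟩ ≠ c₀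
  · have hv2 : v ⟨2, by omega⟩ = c := by
      have := hv.2
      rwa [label, if_pos hnear] at this
    obtain ⟨⟨x, hx, a, ha, ha2, ham, rfl⟩, hne⟩ := hnear
    have h := (mul_gen_mul_gen_mem_connector hn hm hconf hx ha2 ham (fun _ => hne)).1
    rw [hv2, ← hD] at h
    exact (hreach' _ h ((mul_gen_mul_gen_apply hn hm _).trans hv2)).tail
      ⟨(adj_mul_gen hn m.2 _).symm, h, hv⟩
  · refine hreach' v hv ?_
    have := hv.2
    rwa [label, if_neg hnear] at this

theorem exists_isIDSTFamily_of_noConflict (hn : 3 ≤ n) {S : Set (Equiv.Perm (Fin n))}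
    (hS : Separated S) {m c₀ : Fin n} (hm : 3 ≤ (m : ℕ))
    (hconf : ∀ x ∈ S, ∀ y ∈ S, x ≠ y → NoConflict hn m c₀ x y) :
    ∃ T : Fin (n - 1) → (godanGraph n hn).Subgraph, IsIDSTFamily (godanGraph n hn) S T := by
  have hcard : Fintype.card {c : Fin n // c ≠ c₀} = n - 1 := by simp
  let e := (Fintype.equivFinOfCardEq hcard).symm
  choose r hr using fun c : {c : Fin n // c ≠ c₀} =>
    exists_root_connector (c := c.1) hn hS hm hconf
  refine exists_isIDSTFamily_of_connectors (fun i => connector hn S m c₀ (e i)) (fun i => r (e i))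
    (fun i v hv => hv.1) ?_ (fun i => (hr (e i)).1) (fun i => (hr (e i)).2)
    (fun i x hx => exists_mem_connector_adj hn hS hm hconf (e i).2 hx)
  intro i j hij v hi hj
  exact hij (e.injective (Subtype.ext (hi.2.symm.trans hj.2)))

end Labelling

section Large

variable {n : ℕ}

theorem noConflict_of_seven_le (hn : 7 ≤ n) {S : Set (Equiv.Perm (Fin n))} (hS : Separated S)
    {m : Fin n} (c : Fin n) {x y : Equiv.Perm (Fin n)} (hx : x ∈ S) (hy : y ∈ S)
    (hxy : x ≠ y) : NoConflict (by omega) m c x y := by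
  intro a b _ _ _ _ h
  have hcard : ({0, 1, 2, (m : ℕ), a, b} : Finset ℕ).card < (Finset.range n).card := by
    rw [Finset.card_range]
    exact lt_of_le_of_lt Finset.card_le_six (by omega)
  obtain ⟨k, hkn, hk⟩ := Finset.exists_mem_notMem_of_card_lt_card hcard
  rw [Finset.mem_range] at hkn
  simp only [Finset.mem_insert, Finset.mem_singleton, not_or] at hk
  obtain ⟨h0, h1, h2, hkm, hka, hkb⟩ := hk
  have hk3 : 3 ≤ ((⟨k, hkn⟩ : Fin n) : ℕ) := by simp only; omega
  refine absurd (hS x hx y hy ⟨k, hkn⟩ hk3 ?_) hxy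
  have := congrArg (fun s : Equiv.Perm (Fin n) => s ⟨k, hkn⟩) h
  simpa only [mul_gen_apply _ hk3 (Ne.symm hkm), mul_gen_apply _ hk3 (Ne.symm hka),
    mul_gen_apply _ hk3 (Ne.symm hkb)] using this

/-- The relation between two permutations of six symbols which is the only obstruction to
`NoConflict`. -/
def SixRel (m : Fin 6) (x y : Equiv.Perm (Fin 6)) : Prop :=
  y (x⁻¹ (y 2)) = x m ∧ y (x⁻¹ (y m)) = x 2 ∧ y 0 = x 1 ∧ y 1 = x 0

theorem SixRel.symm {m : Fin 6} {x y : Equiv.Perm (Fin 6)} (h : SixRel m x y) :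
    SixRel m y x := by
  obtain ⟨h1, h2, h3, h4⟩ := h
  refine ⟨?_, ?_, h4.symm, h3.symm⟩
  · rw [← h2]; simp
  · rw [← h1]; simp

theorem noConflict_six {S : Set (Equiv.Perm (Fin 6))} (hS : Separated S) {m : Fin 6}
    (hm : 3 ≤ (m : ℕ)) {z x y : Equiv.Perm (Fin 6)} (hx : x ∈ S) (hy : y ∈ S)
    (hxy : x ≠ y) (h : x ≠ z → y ≠ z → ¬ SixRel m x y) :
    NoConflict (by omega) m (z m) x y := by
  intro a b ha ham hb hbm hab
  have hev : ∀ k : Fin 6, 3 ≤ (k : ℕ) → k ≠ m → a = k ∨ b = k := by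
    intro k hk hkm
    by_contra! hne
    refine hxy (hS x hx y hy k hk ?_)
    have := congrArg (fun s : Equiv.Perm (Fin 6) => s k) hab
    simpa only [mul_gen_apply _ hk (fun h => hkm (Fin.ext h.symm)), mul_gen_apply _ hk hne.1,
      mul_gen_apply _ hk hne.2] using this
  have hpair : ∃ k l : Fin 6, 3 ≤ (k : ℕ) ∧ 3 ≤ (l : ℕ) ∧ k ≠ m ∧ l ≠ m ∧ k ≠ l ∧
      a = k ∧ b = l := by
    obtain ⟨k, l, hk, hl, hkm, hlm, hkl⟩ : ∃ k l : Fin 6, 3 ≤ (k : ℕ) ∧ 3 ≤ (l : ℕ) ∧ k ≠ m ∧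
        l ≠ m ∧ k ≠ l := by
      revert hm; clear * -; revert m; decide
    rcases hev k hk hkm with h1 | h1 <;> rcases hev l hl hlm with h2 | h2
    · exact absurd (Fin.ext (h1.symm.trans h2)) hkl
    · exact ⟨k, l, hk, hl, hkm, hlm, hkl, h1, h2⟩
    · exact ⟨l, k, hl, hk, hlm, hkm, hkl.symm, h2, h1⟩
    · exact absurd (Fin.ext (h1.symm.trans h2)) hkl
  obtain ⟨k, l, hk, hl, hkm, hlm, hkl, rfl, rfl⟩ := hpair
  have hn : 3 ≤ 6 := by omega
  have hy' : y = x * gen hn k * gen hn m * gen hn l := by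
    rw [hab, mul_assoc, gen_mul_self hn (by omega), mul_one]
  have val : ∀ i, y i = x (gen hn k (gen hn m (gen hn l i))) := fun i => by rw [hy']; rfl
  have hne : ∀ {i j : Fin 6}, i ≠ j → (i : ℕ) ≠ j := fun h h' => h (Fin.ext h')
  have g2 : ∀ i : Fin 6, 3 ≤ (i : ℕ) → gen hn i 2 = i := fun i hi => gen_apply_two hn hi
  have gs : ∀ i : Fin 6, 3 ≤ (i : ℕ) → gen hn i i = 2 := fun i hi => gen_apply_self hn hi
  have y2 : y 2 = x l := by
    rw [val, g2 l hl, gen_apply_of_ne hn hl (hne hlm), gen_apply_of_ne hn hl (hne hkl.symm)]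
  have yl : y l = x m := by
    rw [val, gs l hl, g2 m hm, gen_apply_of_ne hn hm (hne hkm.symm)]
  have ym : y m = x k := by
    rw [val, gen_apply_of_ne hn hm (hne hlm.symm), gs m hm, g2 k hk]
  have yk : y k = x 2 := by
    rw [val, gen_apply_of_ne hn hk (hne hkl), gen_apply_of_ne hn hk (hne hkm), gs k hk]
  have g0 : ∀ i : Fin 6, 3 ≤ (i : ℕ) → gen hn i 0 = 1 := fun i hi => by
    apply Fin.ext; rw [gen_apply_val hn i.2]; simp; omega
  have g1 : ∀ i : Fin 6, 3 ≤ (i : ℕ) → gen hn i 1 = 0 := fun i hi => by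
    apply Fin.ext; rw [gen_apply_val hn i.2]; simp; omega
  by_cases hxz : x = z
  · right
    refine ⟨l.2, ?_⟩
    rw [Equiv.Perm.mul_apply, gen_apply_two hn hl, yl, hxz]
  by_cases hyz : y = z
  · left
    refine ⟨k.2, ?_⟩
    rw [Equiv.Perm.mul_apply, gen_apply_two hn hk, ← ym, hyz]
  refine absurd ⟨?_, ?_, ?_, ?_⟩ (h hxz hyz)
  · simp [y2, yl]
  · simp [ym, yk]
  · rw [val, g0 l hl, g1 m hm, g0 k hk]
  · rw [val, g1 l hl, g0 m hm, g1 k hk]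

theorem exists_not_sixRel (a b c : Equiv.Perm (Fin 6)) :
    ∃ m : Fin 6, 3 ≤ (m : ℕ) ∧ ¬ SixRel m a b ∧ ¬ SixRel m b c ∧ ¬ SixRel m a c := by
  by_contra! h
  have huniq : ∀ (x y : Equiv.Perm (Fin 6)) (m m' : Fin 6), SixRel m x y → SixRel m' x y →
      m = m' := fun x y m m' h1 h2 => x.injective (h1.1.symm.trans h2.1)
  have hcyc : ∀ m m' m'' : Fin 6, SixRel m a b → SixRel m' b c → SixRel m'' a c → False := by
    intro m m' m'' h1 h2 h3
    have : a 0 = a 1 := by rw [← h1.2.2.2, ← h2.2.2.1, h3.2.2.1]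
    exact absurd (a.injective this) (by decide)
  have hex : ∀ m : Fin 6, 3 ≤ (m : ℕ) → SixRel m a b ∨ SixRel m b c ∨ SixRel m a c := by
    intro m hm
    by_contra! hn
    exact hn.2.2 (h m hm hn.1 hn.2.1)
  have d34 : (3 : Fin 6) ≠ 4 := by decide
  have d35 : (3 : Fin 6) ≠ 5 := by decide
  have d45 : (4 : Fin 6) ≠ 5 := by decide
  rcases hex 3 (by decide) with h3 | h3 | h3 <;> rcases hex 4 (by decide) with h4 | h4 | h4 <;>
    rcases hex 5 (by decide) with h5 | h5 | h5 <;>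
    first
    | exact d34 (huniq _ _ _ _ h3 h4)
    | exact d35 (huniq _ _ _ _ h3 h5)
    | exact d45 (huniq _ _ _ _ h4 h5)
    | exact hcyc _ _ _ h3 h4 h5
    | exact hcyc _ _ _ h3 h5 h4
    | exact hcyc _ _ _ h4 h3 h5
    | exact hcyc _ _ _ h4 h5 h3
    | exact hcyc _ _ _ h5 h3 h4
    | exact hcyc _ _ _ h5 h4 h3

theorem exists_isIDSTFamily_seven_le (hn : 7 ≤ n) {S : Set (Equiv.Perm (Fin n))}
    (hS : Separated S) :
    ∃ T : Fin (n - 1) → (godanGraph n (by omega)).Subgraph,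
      IsIDSTFamily (godanGraph n (by omega)) S T :=
  exists_isIDSTFamily_of_noConflict (by omega) hS (m := ⟨3, by omega⟩) (c₀ := ⟨0, by omega⟩) le_rfl
    fun _ hx _ hy hxy => noConflict_of_seven_le hn hS _ hx hy hxy

theorem exists_isIDSTFamily_six {z a b c : Equiv.Perm (Fin 6)}
    (hS : Separated ({z, a, b, c} : Set (Equiv.Perm (Fin 6)))) :
    ∃ T : Fin (6 - 1) → (godanGraph 6 (by omega)).Subgraph,
      IsIDSTFamily (godanGraph 6 (by omega)) {z, a, b, c} T := by
  obtain ⟨m, hm, hab, hbc, hac⟩ := exists_not_sixRel a b c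
  refine exists_isIDSTFamily_of_noConflict (by omega) hS (m := m) (c₀ := z m) hm
    fun x hx y hy hxy => noConflict_six hS hm hx hy hxy fun hxz hyz => ?_
  have hx' : x = a ∨ x = b ∨ x = c := hx.resolve_left hxz
  have hy' : y = a ∨ y = b ∨ y = c := hy.resolve_left hyz
  rcases hx' with rfl | rfl | rfl <;> rcases hy' with rfl | rfl | rfl <;>
    first
    | exact absurd rfl hxy
    | assumption
    | exact fun h => hab h.symm
    | exact fun h => hbc h.symm
    | exact fun h => hac h.symm

end Large

section Force

variable {β : Type*}

/-- Application of a function to a natural number that is evaluated first. -/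
def force (n : ℕ) (k : ℕ → β) : β :=
  match n with
  | 0 => k 0
  | m + 1 => k (Nat.succ m)

theorem force_eq (n : ℕ) (k : ℕ → β) : force n k = k n := by
  cases n <;> rfl

/-- Application of a function to a list of natural numbers that is evaluated first. -/
def forceList : List ℕ → (List ℕ → β) → β
  | [], k => k []
  | a :: l, k => force a fun a => forceList l fun l => k (a :: l)

theorem forceList_eq : ∀ (l : List ℕ) (k : List ℕ → β), forceList l k = k l
  | [], _ => rfl
  | a :: l, k => by rw [forceList, force_eq, forceList_eq l]

/-- Application of a function to a list of words that is evaluated first. -/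
def forceWords : List (List ℕ) → (List (List ℕ) → β) → β
  | [], k => k []
  | a :: l, k => forceList a fun a => forceWords l fun l => k (a :: l)

theorem forceWords_eq : ∀ (l : List (List ℕ)) (k : List (List ℕ) → β), forceWords l k = k l
  | [], _ => rfl
  | a :: l, k => by rw [forceWords, forceList_eq, forceWords_eq l]

/-- Equality of words. -/
def wordBeq : List ℕ → List ℕ → Bool
  | [], [] => true
  | a :: l, b :: l' => Nat.beq a b && wordBeq l l'
  | _, _ => false

theorem wordBeq_iff : ∀ {l l' : List ℕ}, wordBeq l l' = true ↔ l = l'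
  | [], [] => by simp [wordBeq]
  | [], _ :: _ => by simp [wordBeq]
  | _ :: _, [] => by simp [wordBeq]
  | a :: l, b :: l' => by
    rw [wordBeq, Bool.and_eq_true, Nat.beq_eq, wordBeq_iff, List.cons.injEq]

/-- Membership in a list of words. -/
def wordMem (w : List ℕ) : List (List ℕ) → Bool
  | [] => false
  | a :: l => wordBeq w a || wordMem w l

theorem wordMem_iff {w : List ℕ} : ∀ {l : List (List ℕ)}, wordMem w l = true ↔ w ∈ l
  | [] => by simp [wordMem]
  | a :: l => by rw [wordMem, Bool.or_eq_true, wordBeq_iff, wordMem_iff, List.mem_cons]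

end Force

section Words

/-- The word `σ(0) σ(1) ⋯` of a permutation. -/
def word {n : ℕ} (σ : Equiv.Perm (Fin n)) : List ℕ := List.ofFn fun i => (σ i : ℕ)

/-- The action of `gen a` on words with four or five letters. -/
def step : ℕ → List ℕ → List ℕ
  | 0, a :: b :: c :: t => c :: a :: b :: t
  | 1, a :: b :: c :: t => b :: c :: a :: t
  | 2, a :: b :: c :: t => b :: a :: c :: t
  | 3, a :: b :: c :: d :: t => b :: a :: d :: c :: t
  | 4, a :: b :: c :: d :: e :: t => b :: a :: e :: d :: c :: t
  | _, w => w

theorem word_injective {n : ℕ} : Function.Injective (word (n := n)) := by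
  intro σ τ h
  have := List.ofFn_injective h
  ext i
  exact congrFun this i

theorem word_mul_gen_four {a : ℕ} (ha : a ≤ 4) (v : Equiv.Perm (Fin 4)) :
    word (v * gen (by omega) a) = step a (word v) := by
  rcases Nat.lt_or_eq_of_le ha with h | rfl
  · have key : ∀ i j : Fin 4, ((if (i : ℕ) = 2 then if a = 0 then 1 else if a = 1 then 0 else a
      else if (i : ℕ) = a then 2
      else if (i : ℕ) = 0 then 1 else if (i : ℕ) = 1 then 0 else i) = (j : ℕ)) →
        v (gen (n := 4) (by omega) a i) = v j := by
      intro i j hij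
      exact congrArg v (Fin.ext ((gen_apply_val _ h i).trans hij))
    interval_cases a
    · simp [word, step, List.ofFn_succ, key 0 2, key 1 0, key 2 1, key 3 3]
    · simp [word, step, List.ofFn_succ, key 0 1, key 1 2, key 2 0, key 3 3]
    · simp [word, step, List.ofFn_succ, key 0 1, key 1 0, key 2 2, key 3 3]
    · simp [word, step, List.ofFn_succ, key 0 1, key 1 0, key 2 3, key 3 2]
  · rw [gen_of_le (by omega) le_rfl, mul_one]
    simp [word, step]

theorem word_mul_gen_five {a : ℕ} (ha : a ≤ 5) (v : Equiv.Perm (Fin 5)) :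
    word (v * gen (by omega) a) = step a (word v) := by
  rcases Nat.lt_or_eq_of_le ha with h | rfl
  · have key : ∀ i j : Fin 5, ((if (i : ℕ) = 2 then if a = 0 then 1 else if a = 1 then 0 else a
      else if (i : ℕ) = a then 2
      else if (i : ℕ) = 0 then 1 else if (i : ℕ) = 1 then 0 else i) = (j : ℕ)) →
        v (gen (n := 5) (by omega) a i) = v j := by
      intro i j hij
      exact congrArg v (Fin.ext ((gen_apply_val _ h i).trans hij))
    interval_cases a
    · simp [word, step, List.ofFn_succ, key 0 2, key 1 0, key 2 1, key 3 3, key 4 4]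
    · simp [word, step, List.ofFn_succ, key 0 1, key 1 2, key 2 0, key 3 3, key 4 4]
    · simp [word, step, List.ofFn_succ, key 0 1, key 1 0, key 2 2, key 3 3, key 4 4]
    · simp [word, step, List.ofFn_succ, key 0 1, key 1 0, key 2 3, key 3 2, key 4 4]
    · simp [word, step, List.ofFn_succ, key 0 1, key 1 0, key 2 4, key 3 3, key 4 2]
  · rw [gen_of_le (by omega) le_rfl, mul_one]
    simp [word, step]

theorem word_mem_permutations' {n : ℕ} (σ : Equiv.Perm (Fin n)) :
    word σ ∈ (List.ofFn fun i : Fin n => (i : ℕ)).permutations' := by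
  rw [List.mem_permutations']
  exact σ.ofFn_comp_perm fun i : Fin n => (i : ℕ)

theorem word_getD {n : ℕ} (σ : Equiv.Perm (Fin n)) (i : Fin n) : (word σ).getD i 0 = σ i := by
  simp [word, List.getD]

end Words

section Certificates

variable {α β : Type*}

/-- Grow a tree: an instruction `(p, g)` joins the node added `p` steps ago to its image under
move `g`. The result consists of the nodes, in reverse order, and of the edges. -/
def grow (st : ℕ → α → α) (r : α) :
    List (ℕ × ℕ) → List α → List (α × α) → List α × List (α × α)
  | [], ns, es => (ns, es)
  | (p, g) :: l, ns, es =>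
    grow st r l (st g (ns.getD p r) :: ns) ((ns.getD p r, st g (ns.getD p r)) :: es)

theorem grow_map (st : ℕ → α → α) (st' : ℕ → β → β) (f : α → β) (r : α) :
    ∀ (l : List (ℕ × ℕ)) (ns : List α) (es : List (α × α)),
      (∀ p ∈ l, ∀ v, f (st p.2 v) = st' p.2 (f v)) →
      grow st' (f r) l (ns.map f) (es.map (Prod.map f f)) =
        ((grow st r l ns es).1.map f, (grow st r l ns es).2.map (Prod.map f f))
  | [], ns, es, _ => rfl
  | (p, g) :: l, ns, es, h => by
    have hg := h (p, g) (by simp)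
    have := grow_map st st' f r l (st g (ns.getD p r) :: ns)
      ((ns.getD p r, st g (ns.getD p r)) :: es) (fun q hq => h q (by simp [hq]))
    rw [grow, grow, ← this]
    simp only [List.map_cons, Prod.map, hg, List.getD_map]

theorem grow_spec (st : ℕ → α → α) (r : α) (Q : α → α → Prop) :
    ∀ (l : List (ℕ × ℕ)) (ns : List α) (es : List (α × α)),
      (∀ p ∈ l, ∀ v, Q v (st p.2 v)) → r ∈ ns →
      (∀ e ∈ es, e.1 ∈ ns ∧ e.2 ∈ ns ∧ Q e.1 e.2) →
      (∀ v ∈ ns, Relation.ReflTransGen (fun a b => (a, b) ∈ es) r v) →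
      r ∈ (grow st r l ns es).1 ∧
      (∀ e ∈ (grow st r l ns es).2,
        e.1 ∈ (grow st r l ns es).1 ∧ e.2 ∈ (grow st r l ns es).1 ∧ Q e.1 e.2) ∧
      ∀ v ∈ (grow st r l ns es).1,
        Relation.ReflTransGen (fun a b => (a, b) ∈ (grow st r l ns es).2) r v
  | [], ns, es, _, hr, he, hc => ⟨hr, he, hc⟩
  | (p, g) :: l, ns, es, hl, hr, he, hc => by
    have hu : ns.getD p r ∈ ns := by
      rw [List.getD_eq_getElem?_getD]
      rcases h : ns[p]? with _ | u
      · exact hr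
      · exact List.mem_of_getElem? h
    have hc' : ∀ v ∈ ns, Relation.ReflTransGen
        (fun a b => (a, b) ∈ (ns.getD p r, st g (ns.getD p r)) :: es) r v := fun v hv =>
      Relation.ReflTransGen.mono (fun a b h => List.mem_cons_of_mem _ h) _ _ (hc v hv)
    refine grow_spec st r Q l _ _ (fun q hq => hl q (by simp [hq])) (List.mem_cons_of_mem _ hr)
      ?_ ?_
    · intro e hmem
      rcases List.mem_cons.mp hmem with rfl | h
      · exact ⟨List.mem_cons_of_mem _ hu, List.mem_cons_self, hl (p, g) (by simp) _⟩
      · exact ⟨List.mem_cons_of_mem _ (he e h).1, List.mem_cons_of_mem _ (he e h).2.1, (he e h).2.2⟩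
    · intro v hv
      rcases List.mem_cons.mp hv with rfl | h
      · exact (hc' _ hu).tail List.mem_cons_self
      · exact hc' v h

/-- Decode a list of instructions for `grow` from the base 256 digits of a number below a
leading digit 1. -/
def decode (n : ℕ) : ℕ → ℕ → List (ℕ × ℕ)
  | 0, _ => []
  | f + 1, N =>
    bif Nat.ble N 1 then [] else
      force (Nat.mod N 256) fun d => (Nat.div d n, Nat.mod d n) :: force (Nat.div N 256) (decode n f)

theorem decode_lt {n : ℕ} (hn : 0 < n) : ∀ (f N : ℕ), ∀ p ∈ decode n f N, p.2 < n
  | 0, N, p, h => by simp [decode] at h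
  | f + 1, N, p, h => by
    rw [decode, force_eq, force_eq] at h
    rcases hb : Nat.ble N 1 with _ | _
    · rw [hb, cond_false] at h
      rcases List.mem_cons.mp h with rfl | h
      · exact Nat.mod_lt _ hn
      · exact decode_lt hn f _ p h
    · rw [hb, cond_true] at h
      simp at h

/-- Grow a tree of words, evaluating each word. -/
def growWords {β : Type*} (r : List ℕ) : List (ℕ × ℕ) → List (List ℕ) →
    List (List ℕ × List ℕ) → (List (List ℕ) × List (List ℕ × List ℕ) → β) → β
  | [], ns, es, k => k (ns, es)
  | (p, g) :: l, ns, es, k =>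
    forceList (ns.getD p r) fun u => forceList (step g u) fun v =>
      growWords r l (v :: ns) ((u, v) :: es) k

theorem growWords_eq {β : Type*} (r : List ℕ) : ∀ (l : List (ℕ × ℕ)) (ns : List (List ℕ))
    (es : List (List ℕ × List ℕ)) (k : List (List ℕ) × List (List ℕ × List ℕ) → β),
    growWords r l ns es k = k (grow step r l ns es)
  | [], _, _, _ => rfl
  | (p, g) :: l, ns, es, k => by
    rw [growWords, forceList_eq, forceList_eq, growWords_eq r l, grow]

/-- Grow several trees of words. -/
def growAll {β : Type*} (n : ℕ) (r : List ℕ) :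
    List ℕ → (List (List (List ℕ) × List (List ℕ × List ℕ)) → β) → β
  | [], k => k []
  | N :: l, k => growWords r (decode n 64 N) [r] [] fun t => growAll n r l fun ts => k (t :: ts)

theorem growAll_eq {β : Type*} (n : ℕ) (r : List ℕ) : ∀ (Ns : List ℕ)
    (k : List (List (List ℕ) × List (List ℕ × List ℕ)) → β),
    growAll n r Ns k = k (Ns.map fun N => grow step r (decode n 64 N) [r] [])
  | [], _ => rfl
  | N :: l, k => by rw [growAll, growWords_eq, growAll_eq n r l, List.map_cons]

/-- Two grown trees share only vertices of `S`, and no edges inside `S`. -/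
def compatible (S : List (List ℕ)) (t t' : List (List ℕ) × List (List ℕ × List ℕ)) : Bool :=
  t.1.all (fun u => !wordMem u t'.1 || wordMem u S) &&
    t.2.all fun e => !(wordMem e.1 S && wordMem e.2 S) ||
      t'.2.all fun e' => !(wordBeq e.1 e'.1 && wordBeq e.2 e'.2) &&
        !(wordBeq e.2 e'.1 && wordBeq e.1 e'.2)

/-- All pairs of entries of a list are related. -/
def allPairs (f : α → α → Bool) : List α → Bool
  | [] => true
  | a :: l => l.all (f a) && allPairs f l

theorem pairwise_of_allPairs {f : α → α → Bool} : ∀ {l : List α}, allPairs f l = true →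
    l.Pairwise fun a b => f a b = true
  | [], _ => List.Pairwise.nil
  | a :: l, h => by
    rw [allPairs, Bool.and_eq_true, List.all_eq_true] at h
    exact List.Pairwise.cons h.1 (pairwise_of_allPairs h.2)

/-- Check that the numbers `Ns` encode suitable trees for the list `r :: S` of vertices. -/
def certifies (n : ℕ) (r : List ℕ) (S : List (List ℕ)) (Ns : List ℕ) : Bool :=
  growAll n r Ns fun ts =>
    Nat.beq Ns.length (n - 1) && ts.all (fun t => S.all fun s => wordMem s t.1) &&
      allPairs (compatible (r :: S)) ts

theorem exists_isIDSTFamily_of_certifies {n : ℕ} (hn : 3 ≤ n)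
    (hstep : ∀ a < n, ∀ v : Equiv.Perm (Fin n), word (v * gen hn a) = step a (word v))
    {z : Equiv.Perm (Fin n)} {S : List (Equiv.Perm (Fin n))} {Ns : List ℕ}
    (h : certifies n (word (z⁻¹ * z)) (S.map fun v => word (z⁻¹ * v)) Ns = true) :
    ∃ T : Fin (n - 1) → (godanGraph n hn).Subgraph,
      IsIDSTFamily (godanGraph n hn) {v | v ∈ z :: S} T := by
  set f : Equiv.Perm (Fin n) → List ℕ := fun v => word (z⁻¹ * v) with hf
  have hinj : Function.Injective f := fun u v huv => mul_left_cancel (word_injective huv)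
  have hinj2 : Function.Injective (Prod.map f f) := hinj.prodMap hinj
  let st : ℕ → Equiv.Perm (Fin n) → Equiv.Perm (Fin n) := fun g v => v * gen hn g
  let t : ℕ → List (Equiv.Perm (Fin n)) × List (Equiv.Perm (Fin n) × Equiv.Perm (Fin n)) :=
    fun N => grow st z (decode n 64 N) [z] []
  have hmap : ∀ N, grow step (f z) (decode n 64 N) [f z] [] =
      ((t N).1.map f, (t N).2.map (Prod.map f f)) := fun N =>
    grow_map st step f z _ [z] [] fun p hp v => by
      have := hstep p.2 (decode_lt (by omega) _ _ p hp) (z⁻¹ * v)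
      rwa [mul_assoc] at this
  have hspec := fun N => grow_spec st z
    (fun u v => (godanGraph n hn).Adj u v) (decode n 64 N) [z] []
    (fun p hp v => adj_mul_gen hn (decode_lt (by omega) _ _ p hp) v) (by simp) (by simp)
    (fun v hv => by rw [List.mem_singleton.mp hv])
  simp only [certifies, growAll_eq, Bool.and_eq_true] at h
  obtain ⟨⟨hlen, hmem⟩, hpair⟩ := h
  have hlen : Ns.length = n - 1 := Nat.eq_of_beq_eq_true hlen
  have hmem : ∀ N ∈ Ns, ∀ s ∈ z :: S, s ∈ (t N).1 := by
    intro N hN s hs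
    rcases List.mem_cons.mp hs with rfl | hs
    · exact (hspec N).1
    · rw [List.all_eq_true] at hmem
      have h1 := hmem _ (List.mem_map_of_mem hN)
      rw [List.all_eq_true] at h1
      have h2 := h1 _ (List.mem_map_of_mem hs)
      rw [wordMem_iff] at h2
      have h3 := hmap N
      simp only [hf] at h3
      rw [h3] at h2
      exact (List.mem_map_of_injective hinj).mp h2
  have hcompat : Ns.Pairwise fun N N' =>
      (∀ u ∈ (t N).1, u ∈ (t N').1 → u ∈ z :: S) ∧
      ∀ u ∈ z :: S, ∀ v ∈ z :: S, (u, v) ∈ (t N).2 → (u, v) ∉ (t N').2 ∧ (v, u) ∉ (t N').2 := by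
    refine (List.pairwise_map.mp (pairwise_of_allPairs hpair)).imp ?_
    intro N N' hNN
    have h3 := hmap N
    have h4 := hmap N'
    simp only [hf] at h3 h4
    rw [h3, h4] at hNN
    have hSmap : word (z⁻¹ * z) :: S.map (fun v => word (z⁻¹ * v)) = (z :: S).map f := rfl
    rw [hSmap] at hNN
    simp only [compatible, Bool.and_eq_true, List.all_eq_true, Bool.or_eq_true,
      Bool.not_eq_true', ← Bool.not_eq_true, wordMem_iff, wordBeq_iff] at hNN
    refine ⟨fun u hu hu' => ?_, fun u hu v hv huv => ?_⟩
    · rcases hNN.1 (f u) (List.mem_map_of_mem hu) with h | h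
      · exact absurd (List.mem_map_of_mem hu') h
      · exact (List.mem_map_of_injective hinj).mp h
    · rcases hNN.2 (f u, f v) (List.mem_map_of_mem (f := Prod.map f f) huv) with h | h
      · exact absurd ⟨List.mem_map_of_mem hu, List.mem_map_of_mem hv⟩ h
      · exact ⟨fun h' => (h _ (List.mem_map_of_mem (f := Prod.map f f) h')).1 ⟨rfl, rfl⟩,
          fun h' => (h _ (List.mem_map_of_mem (f := Prod.map f f) h')).2 ⟨rfl, rfl⟩⟩
  have hget : ∀ i : Fin (n - 1), (i : ℕ) < Ns.length := fun i => by rw [hlen]; exact i.2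
  let N : Fin (n - 1) → ℕ := fun i => Ns[i]'(hget i)
  have hN : ∀ i, N i ∈ Ns := fun i => List.getElem_mem _
  have hlt : ∀ i j : Fin (n - 1), i < j → _ := fun i j hij =>
    List.pairwise_iff_getElem.mp hcompat i j (hget i) (hget j) hij
  let H : Fin (n - 1) → SimpleGraph (Equiv.Perm (Fin n)) := fun i =>
    SimpleGraph.fromRel fun u v => (u, v) ∈ (t (N i)).2
  refine exists_isIDSTFamily H (fun i => {v | v ∈ (t (N i)).1}) (fun _ => z) ?_
    (fun i v hv => hmem _ (hN i) v hv) ?_ ?_ (fun i => (hspec (N i)).1) ?_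
  · intro i u v huv
    rcases huv.2 with h | h
    · exact ((hspec (N i)).2.1 _ h).2.2
    · exact ((hspec (N i)).2.1 _ h).2.2.symm
  · rintro i j hij u ⟨hu, hu'⟩
    rcases lt_or_gt_of_ne hij with h | h
    · exact (hlt i j h).1 u hu hu'
    · exact (hlt j i h).1 u hu' hu
  · have aux : ∀ i j, i < j → ∀ u ∈ z :: S, ∀ v ∈ z :: S, (H i).Adj u v → ¬ (H j).Adj u v := by
      intro i j hij u hu v hv huv huv'
      rcases huv.2 with h | h
      · have := (hlt i j hij).2 u hu v hv h
        exact huv'.2.elim this.1 this.2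
      · have := (hlt i j hij).2 v hv u hu h
        exact huv'.2.elim this.2 this.1
    intro i j hij u hu v hv huv huv'
    rcases lt_or_gt_of_ne hij with h | h
    · exact aux i j h u hu v hv huv huv'
    · exact aux j i h u hu v hv huv' huv
  · intro i v hv
    refine Relation.ReflTransGen.mono (fun a b hab => ?_) _ _ ((hspec (N i)).2.2 v hv)
    obtain ⟨ha, hb, hab'⟩ := (hspec (N i)).2.1 _ hab
    exact ⟨⟨hab'.ne, Or.inl hab⟩, ha, hb⟩

end Certificates

section Small

theorem NoConflict.symm {n : ℕ} {hn : 3 ≤ n} {m c : Fin n} {x y : Equiv.Perm (Fin n)}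
    (hm : 3 ≤ (m : ℕ)) (h : NoConflict hn m c x y) : NoConflict hn m c y x := by
  intro a b ha ham hb hbm heq
  refine (h b a hb hbm ha ham ?_).symm
  rw [← heq, mul_assoc, gen_mul_self hn (by omega), mul_one]

/-- The value modulo 311 of a word in base 6, different for all permutations of five letters. -/
def key (w : List ℕ) : ℕ := Nat.mod (w.foldl (fun s d => Nat.add (Nat.mul 6 s) d) 0) 311

/-- The bit of `N` at position `i`. -/
def has (N i : ℕ) : Bool := Nat.beq (Nat.land (Nat.shiftRight N i) 1) 1

theorem has_eq_testBit (N i : ℕ) : has N i = N.testBit i := by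
  rw [Bool.eq_iff_iff, has, Nat.beq_eq, Nat.testBit_eq_decide_div_mod_eq, decide_eq_true_eq]
  change (N >>> i) &&& 1 = 1 ↔ _
  rw [Nat.and_one_is_mod, Nat.shiftRight_eq_div_pow]

/-- The union of a list of bit sets. -/
def union (l : List ℕ) : ℕ := l.foldr Nat.lor 0

theorem has_lor (M N i : ℕ) : has (Nat.lor M N) i = (has M i || has N i) := by
  simp only [has_eq_testBit]
  exact Nat.testBit_lor M N i

theorem has_land (M N i : ℕ) : has (Nat.land M N) i = (has M i && has N i) := by
  simp only [has_eq_testBit]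
  exact Nat.testBit_land M N i

theorem has_union {l : List ℕ} {v i : ℕ} (hv : v ∈ l) (h : has v i = true) :
    has (union l) i = true := by
  induction l with
  | nil => simp at hv
  | cons a l ih =>
    rw [union, List.foldr_cons, has_lor, Bool.or_eq_true]
    rcases List.mem_cons.mp hv with rfl | hv
    · exact Or.inl h
    · exact Or.inr (ih hv)

theorem has_shiftLeft (i : ℕ) : has (Nat.shiftLeft 1 i) i = true := by
  rw [has_eq_testBit]
  change (1 <<< i).testBit i = true
  rw [Nat.one_shiftLeft, Nat.testBit_two_pow_self]

theorem has_of_foldr_land {i r : ℕ} : ∀ {l : List ℕ}, (∀ v ∈ l, has v i = true) →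
    has r i = true → has (l.foldr Nat.land r) i = true
  | [], _, hr => hr
  | a :: l, h, hr => by
    rw [List.foldr_cons, has_land, Bool.and_eq_true]
    exact ⟨h a (by simp), has_of_foldr_land (fun v hv => h v (by simp [hv])) hr⟩

/-- The set of words `y` of five letters that conflict with `x`, for a label `m` and a third symbol
`c`. Here `{m, k} = {3, 4}`, and the number `5` stands for the identity generator. -/
def blocked (m k c : ℕ) (x : List ℕ) : ℕ :=
  union <| [0, 1, k, 5].flatMap fun a => [0, 1, k, 5].map fun b =>
    bif (!Nat.beq a 5 && Nat.beq ((step a x).getD 2 0) c) ||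
      (!Nat.beq b 5 && Nat.beq ((step m (step a x)).getD 2 0) c) then 0
    else Nat.shiftLeft 1 (key (step b (step m (step a x))))

theorem noConflict_five {m k : Fin 5} (hm : 3 ≤ (m : ℕ)) (hk : 3 ≤ (k : ℕ)) (hmk : m ≠ k)
    {z x y : Equiv.Perm (Fin 5)} {c : Fin 5}
    (h : has (blocked m k c (word (z⁻¹ * x))) (key (word (z⁻¹ * y))) = false) :
    NoConflict (by omega) m (z c) x y := by
  have hmk' : (m : ℕ) ≠ k := fun e => hmk (Fin.ext e)
  have hgen : ∀ a : ℕ, gen (n := 5) (by omega) a = gen (by omega) (min a 5) := by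
    intro a
    rcases le_total a 5 with h | h
    · rw [min_eq_left h]
    · rw [min_eq_right h, gen_of_le _ h, gen_of_le _ le_rfl]
  have hmem : ∀ a : ℕ, a ≠ 2 → a ≠ m → min a 5 ∈ [0, 1, (k : ℕ), 5] := by
    intro a ha ham
    simp only [List.mem_cons, List.not_mem_nil, or_false]
    omega
  have hinv : ∀ b : ℕ, b ≠ 2 → b ≠ m → ∃ b' ∈ [0, 1, (k : ℕ), 5], (b' ≠ 5 → b < 5) ∧
      gen (n := 5) (by omega) b * gen (by omega) b' = 1 := by
    intro b hb hbm
    rcases Nat.lt_or_ge b 2 with h2 | h2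
    · interval_cases b
      · exact ⟨1, by simp, by simp, gen_zero_mul_gen_one _⟩
      · exact ⟨0, by simp, by simp, mul_eq_one_comm.mp (gen_zero_mul_gen_one _)⟩
    · exact ⟨_, hmem b hb hbm, by omega, by rw [← hgen, gen_mul_self _ h2]⟩
  have hsymb : ∀ v : Equiv.Perm (Fin 5), Nat.beq ((word (z⁻¹ * v)).getD 2 0) c = true →
      v 2 = z c := by
    intro v hv
    rw [← Fin.ext ((word_getD (z⁻¹ * v) 2).symm.trans (Nat.eq_of_beq_eq_true hv)),
      ← Equiv.Perm.mul_apply, mul_inv_cancel_left]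
  intro a b ha ham hb hbm heq
  obtain ⟨b', hb', hb5, hbb⟩ := hinv b hb hbm
  have h1 : step (min a 5) (word (z⁻¹ * x)) = word (z⁻¹ * (x * gen (by omega) a)) := by
    rw [← word_mul_gen_five (min_le_right _ _), ← hgen, mul_assoc]
  have h2 : step m (word (z⁻¹ * (x * gen (by omega) a))) =
      word (z⁻¹ * (y * gen (by omega) b)) := by
    rw [← heq, ← word_mul_gen_five (by omega), mul_assoc z⁻¹]
  have hb'5 : b' ≤ 5 := by
    simp only [List.mem_cons, List.not_mem_nil, or_false] at hb'
    omega
  have h3 : step b' (word (z⁻¹ * (y * gen (by omega) b))) = word (z⁻¹ * y) := by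
    rw [← word_mul_gen_five hb'5, mul_assoc z⁻¹, mul_assoc y, hbb, mul_one]
  by_contra hcon
  rw [not_or] at hcon
  refine absurd (has_union (List.mem_flatMap.mpr ⟨_, hmem a ha ham, List.mem_map_of_mem hb'⟩) ?_)
    (Bool.eq_false_iff.mp h)
  rw [h1, h2, h3]
  rcases hbool : (!Nat.beq (min a 5) 5 &&
      Nat.beq ((word (z⁻¹ * (x * gen (by omega) a))).getD 2 0) c) || (!Nat.beq b' 5 &&
      Nat.beq ((word (z⁻¹ * (y * gen (by omega) b))).getD 2 0) c) with _ | _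
  · rw [cond_false]
    exact has_shiftLeft _
  · rw [Bool.or_eq_true, Bool.and_eq_true, Bool.and_eq_true, Bool.not_eq_true',
      Bool.not_eq_true'] at hbool
    rcases hbool with ⟨h5, hc⟩ | ⟨h5, hc⟩
    · have := Nat.ne_of_beq_eq_false h5
      exact absurd ⟨by omega, hsymb _ hc⟩ hcon.1
    · exact absurd ⟨hb5 (Nat.ne_of_beq_eq_false h5), hsymb _ hc⟩ hcon.2

theorem exists_isIDSTFamily_of_unblocked {z : Equiv.Perm (Fin 5)}
    {S : List (Equiv.Perm (Fin 5))} (hS : Separated {v | v ∈ S}) {m k c : Fin 5}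
    (hm : 3 ≤ (m : ℕ)) (hk : 3 ≤ (k : ℕ)) (hmk : m ≠ k)
    (h : (S.map fun v => word (z⁻¹ * v)).Pairwise
      fun x y => has (blocked m k c x) (key y) = false) :
    ∃ T : Fin (5 - 1) → (godanGraph 5 (by omega)).Subgraph,
      IsIDSTFamily (godanGraph 5 (by omega)) {v | v ∈ S} T := by
  have : Std.Symm (NoConflict (n := 5) (by omega) m (z c)) := ⟨fun _ _ h => h.symm hm⟩
  have hp : S.Pairwise (NoConflict (by omega) m (z c)) :=
    (List.pairwise_map.mp h).imp fun h => noConflict_five hm hk hmk h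
  exact exists_isIDSTFamily_of_noConflict (by omega) hS hm
    fun x hx y hy hxy => hp.forall hx hy hxy

/-- Words with increasing last symbols and distinct fourth symbols. -/
def before (n : ℕ) (x y : List ℕ) : Bool :=
  Nat.blt (x.getD (n - 1) 0) (y.getD (n - 1) 0) && !Nat.beq (x.getD 3 0) (y.getD 3 0)

/-- The increasing triples of entries of a list. -/
def triples {α : Type*} (r : α → α → Bool) (C : List α) : List (List α) :=
  C.flatMap fun a => (C.filter (r a)).flatMap fun b =>
    ((C.filter (r a)).filter (r b)).map fun c => [a, b, c]

theorem mem_triples {α : Type*} {r : α → α → Bool} {C : List α} {a b c : α} (ha : a ∈ C)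
    (hb : b ∈ C) (hc : c ∈ C) (hab : r a b = true) (hac : r a c = true) (hbc : r b c = true) :
    [a, b, c] ∈ triples r C :=
  List.mem_flatMap.mpr ⟨a, ha, List.mem_flatMap.mpr ⟨b, List.mem_filter.mpr ⟨hb, hab⟩,
    List.mem_map.mpr ⟨c, List.mem_filter.mpr ⟨List.mem_filter.mpr ⟨hc, hac⟩, hbc⟩, rfl⟩⟩⟩

/-- The permutations of the word `0 1 ⋯ (n - 1)` that are `before` it. -/
def candidates (n : ℕ) : List (List ℕ) :=
  (List.range n).permutations'.filter fun w => before n w (List.range n)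

/-- The parameters for `blocked`. -/
def choices : List (Fin 5 × Fin 5 × Fin 5) :=
  [(3, 4, 0), (3, 4, 1), (3, 4, 2), (3, 4, 3), (3, 4, 4),
    (4, 3, 0), (4, 3, 1), (4, 3, 2), (4, 3, 3), (4, 3, 4)]

/-- The sets `blocked` of a word for all choices of parameters. -/
def blockedAll (x : List ℕ) : List ℕ :=
  choices.map fun p => blocked p.1 p.2.1 p.2.2 x

/-- The set of the words in `C` after the word `x`. -/
def after (C : List (List ℕ)) (x : List ℕ) : ℕ :=
  union <| C.map fun y => bif before 5 x y then Nat.shiftLeft 1 (key y) else 0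

/-- The data of a word used by `unsolved`. -/
abbrev Row : Type := ℕ × ℕ × List ℕ × List ℕ

/-- The data of the word `x`. -/
def row (C : List (List ℕ)) (x : List ℕ) : Row := (key x, after C x, blockedAll x, x)

/-- Application of a function to the rows of several words, evaluated first. -/
def forceRows {β : Type*} (C : List (List ℕ)) : List (List ℕ) → (List Row → β) → β
  | [], k => k []
  | x :: l, k =>
    force (key x) fun i => force (after C x) fun R => forceList (blockedAll x) fun K =>
      forceRows C l fun rs => k ((i, R, K, x) :: rs)

theorem forceRows_eq {β : Type*} (C : List (List ℕ)) : ∀ (l : List (List ℕ)) (k : List Row → β),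
    forceRows C l k = k (l.map (row C))
  | [], _ => rfl
  | x :: l, k => by
    rw [forceRows, force_eq, force_eq, forceList_eq, forceRows_eq C l, List.map_cons, row]

/-- Add a word to lists of words with given sets of blocked words, where it may be blocked. -/
def extend (U : List ℕ) (x : Row) : List ℕ :=
  U.zipWith (fun u K => bif has u x.1 then x.2.1 else Nat.lor u K) x.2.2.1

/-- The increasing triples of entries of `C` for which every choice of parameters is blocked. -/
def unsolved (C : List (List ℕ)) : List (List (List ℕ)) :=
  forceWords C fun C => forceList (blockedAll (List.range 5)) fun U => forceRows C C fun rows =>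
    rows.flatMap fun a => forceList (extend U a) fun U => rows.flatMap fun b =>
      bif has a.2.1 b.1 then
        force ((extend U b).foldr Nat.land (Nat.land a.2.1 b.2.1)) fun B =>
          bif Nat.beq B 0 then []
          else (rows.filter fun c => has B c.1).map fun c => [a.2.2.2, b.2.2.2, c.2.2.2]
      else []

theorem has_after {C : List (List ℕ)} {x y : List ℕ} (hy : y ∈ C) (h : before 5 x y = true) :
    has (after C x) (key y) = true := by
  refine has_union (List.mem_map_of_mem hy) ?_
  rw [h, cond_true]
  exact has_shiftLeft _

theorem extend_map (f : Fin 5 × Fin 5 × Fin 5 → ℕ) (C : List (List ℕ)) (x : List ℕ) :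
    extend (choices.map f) (row C x) = choices.map fun p =>
      bif has (f p) (key x) then after C x else Nat.lor (f p) (blocked p.1 p.2.1 p.2.2 x) := by
  simp only [extend, row, blockedAll, List.zipWith_map, List.zipWith_self]

theorem exists_unblocked {C : List (List ℕ)} {a b c : List ℕ} (ha : a ∈ C) (hb : b ∈ C)
    (hc : c ∈ C) (hab : before 5 a b = true) (hac : before 5 a c = true)
    (hbc : before 5 b c = true) (h : [a, b, c] ∉ unsolved C) :
    ∃ p ∈ choices, [List.range 5, a, b, c].Pairwise fun x y =>
      has (blocked p.1 p.2.1 p.2.2 x) (key y) = false := by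
  by_contra! hcon
  refine h ?_
  simp only [unsolved, forceWords_eq, forceList_eq, force_eq, forceRows_eq]
  refine List.mem_flatMap.mpr ⟨row C a, List.mem_map_of_mem ha,
    List.mem_flatMap.mpr ⟨row C b, List.mem_map_of_mem hb, ?_⟩⟩
  have h1 : has (row C a).2.1 (row C b).1 = true := has_after hb hab
  rw [h1, cond_true, blockedAll, extend_map, extend_map]
  set B := List.foldr _ _ _ with hB
  have h2 : has B (key c) = true := by
    refine has_of_foldr_land (fun v hv => ?_) ?_
    · obtain ⟨p, hp, rfl⟩ := List.mem_map.mp hv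
      have h3 := hcon p hp
      by_contra h4
      refine h3 ?_
      have hb' := has_after hb hab
      have hc' := has_after hc hbc
      grind [has_lor, List.pairwise_cons]
    · rw [has_land, Bool.and_eq_true]
      exact ⟨has_after hc hac, has_after hc hbc⟩
  have h3 : Nat.beq B 0 = false := by
    refine Bool.eq_false_iff.mpr fun h0 => ?_
    rw [Nat.eq_of_beq_eq_true h0, has_eq_testBit, Nat.zero_testBit] at h2
    exact absurd h2 (by decide)
  rw [h3, cond_false]
  exact List.mem_map.mpr ⟨row C c, List.mem_filter.mpr ⟨List.mem_map_of_mem hc, h2⟩, rfl⟩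

/-- Check successive lists of words against successive lists of trees. -/
def certifiesAll (n : ℕ) (r : List ℕ) : List (List (List ℕ)) → List (List ℕ) → Bool
  | [], _ => true
  | _ :: _, [] => false
  | S :: l, Ns :: t => certifies n r S Ns && certifiesAll n r l t

theorem exists_certifies {n : ℕ} {r : List ℕ} {S : List (List ℕ)} :
    ∀ {l : List (List (List ℕ))} {t : List (List ℕ)}, certifiesAll n r l t = true → S ∈ l →
      ∃ Ns, certifies n r S Ns = true
  | [], _, _, h => by simp at h
  | _ :: _, [], h, _ => by simp [certifiesAll] at h
  | S' :: l, Ns :: t, h, hS => by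
    rw [certifiesAll, Bool.and_eq_true] at h
    rcases List.mem_cons.mp hS with rfl | hS
    · exact ⟨Ns, h.1⟩
    · exact exists_certifies h.2 hS

theorem word_one (n : ℕ) : word (1 : Equiv.Perm (Fin n)) = List.range n := by
  exact List.ext_getElem (by simp [word]) fun i h h' => by simp [word]

theorem before_word {n : ℕ} (hn : 4 ≤ n) {S : Set (Equiv.Perm (Fin n))} (hS : Separated S)
    {z a b : Equiv.Perm (Fin n)} (ha : a ∈ S) (hb : b ∈ S)
    (h : (z⁻¹ * a) ⟨n - 1, by omega⟩ < (z⁻¹ * b) ⟨n - 1, by omega⟩) :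
    before n (word (z⁻¹ * a)) (word (z⁻¹ * b)) = true := by
  have h1 := word_getD (z⁻¹ * a) ⟨n - 1, by omega⟩
  have h2 := word_getD (z⁻¹ * b) ⟨n - 1, by omega⟩
  have h3 := word_getD (z⁻¹ * a) ⟨3, by omega⟩
  have h4 := word_getD (z⁻¹ * b) ⟨3, by omega⟩
  simp only at h1 h2 h3 h4
  rw [before, h1, h2, h3, h4, Bool.and_eq_true, Bool.not_eq_true', Nat.blt_eq]
  refine ⟨h, Bool.eq_false_iff.mpr fun h' => ?_⟩
  have h5 : a ⟨3, by omega⟩ = b ⟨3, by omega⟩ :=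
    z⁻¹.injective (Fin.ext (Nat.eq_of_beq_eq_true h'))
  rw [hS a ha b hb _ le_rfl h5] at h
  exact lt_irrefl _ h

theorem word_mem_candidates {n : ℕ} (hn : 4 ≤ n) {S : Set (Equiv.Perm (Fin n))}
    (hS : Separated S) {z v : Equiv.Perm (Fin n)} (hz : z ∈ S) (hv : v ∈ S)
    (h : (z⁻¹ * v) ⟨n - 1, by omega⟩ < (z⁻¹ * z) ⟨n - 1, by omega⟩) :
    word (z⁻¹ * v) ∈ candidates n := by
  have hr : List.range n = word (z⁻¹ * z) := by rw [inv_mul_cancel, word_one]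
  have hp := word_mem_permutations' (z⁻¹ * v)
  change _ ∈ List.permutations' (word 1) at hp
  rw [word_one] at hp
  exact List.mem_filter.mpr ⟨hp, hr ▸ before_word hn hS hv hz h⟩

end Small

section Tables

/-- Trees for the increasing triples of `candidates 4`. -/
def treesFour : List (List ℕ) := [
  [18519372344414438146, 4722872580375446945795, 4722872013040214213376],
  [19170427281328242946, 1213777313870077136864001, 4741318760408213947136],
  [4741608966636909823746, 4796587787182636335873, 18952274244278551296],
  [18593967619963094786, 4741029963787818631937, 4722872016334504395520],
  [19170425082304987394, 4815105169359313699585, 4814961337832386396928],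
  [18809010099828557315, 18738082812266545921, 4759765501187633316608],
  [289218954199042, 1232611655742133983249153, 4741030526733594787843],
  [74884485862457346, 1213703815688207982527232, 4814962469251359834881],
  [75165952215614210, 1227889289259247124742913, 18519650495069552643],
  [18954252278649259520, 18520776407861297411, 4814890411657321906945],
  [74321535909036034, 4796370196009014395649, 4741031657044365672451],
  [4741320735148294473216, 18448719917629964291, 18519651620401251073],
  [1213703889443456614335744, 72623846871794434, 18952560113124507651],
  [310727103175319398895452928, 4722582939338660839426, 18809010099761316609],
  [19241920812999443968, 4722871450090277568515, 74035632703406849],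
  [4833697729600114918402, 4759477270807237099779, 72903148645122817],
  [19097526361921946626, 18663480918240527105, 4759766911869692018691],
  [4741608966615367878144, 18591708089107480579, 74040047963276033],
  [73472712882192642, 1218389505140481589641219, 18519646105579422465],
  [18521908935003668482, 1213703815693722686849792, 4796515725177650283265],
  [18809577460747010050, 18447589611053121539, 4759622237025919435521],
  [1209110938679880339357954, 72060896918241539, 18879935192544314113],
  [18809295985770299394, 4759764938254960296705, 4722873423722272915459],
  [4815322757217238058496, 74033437958340611, 18448722116686775041],
  [74036749445563904, 18448720999961592323, 4722872297831006208769],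
  [18593967624174174978, 4722872016356029498112, 4814962469264244736769],
  [19026310993740760066, 4722584065238567616515, 18809010082564670209],
  [4741030815939479144192, 4833480137313962098690, 4796515729592893309697],
  [19026309894229132290, 18951710194830279425, 1213777676139375987130371],
  [18520779706413286912, 18880504739483746307, 18520779723609604865],
  [1213777601824488872674305, 284777857155842, 4759765787056412033539],
  [18519654914658336770, 4722872016356029498112, 4815034526862560854785],
  [18737519866709082114, 18447589611053121539, 18881067676602598145],
  [4833625672006076989698, 18952554615566303235, 18664326459895579393],
  [18449852427592270594, 18662919067798733569, 18665174174720458755],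
  [1232611874455904699482114, 74033416483504131, 18592837317647532801],
  [18519648291818767873, 18447593996248416771, 1209055380576097137722112],
  [80472175627888574271255020035, 1208981161542327415930882, 72342389142258689],
  [4740959317953943635457, 18447593996315394051, 4833552477482471523072],
  [4833482401234291066626, 1218389504859028003488513, 72060896918110976],
  [4907556763488991117314, 4851783618325452883712, 4741318761529183568641],
  [4741317913775738127873, 1218463220622123686035459, 72906421359936256],
  [73754170695615234, 18736108076481643011, 4722872298913270858497],
  [18881916529761583362, 4814890411674484998912, 4741319041904648717057],
  [18881635054784872706, 18448718818185445379, 18952560117335196417],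
  [4907557607901002728194, 18808165666157428995, 4741030530049242104577],
  [18881353579808162050, 18735821078159950593, 1213704105052197852676099],
  [4814962469268522926848, 1208981521830297555175170, 18519650520822514433],
  [4741031098488231232768, 18591709192981512194, 72907516576793091],
  [4759766064154867401474, 309518084977587720957264640, 72060896918110977],
  [4722512578295460463872, 4759767480321448280066, 72907516643770371],
  [1256334602666350934754306, 4759477274105771983107, 284777856893697],
  [4833698570726460032002, 72904222336615169, 1218426183306881779499011],
  [18519654910363370752, 1237371205358590007377922, 284794986627075],
  [18808733035816878082, 4722582662248879358467, 18519648296046166785],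
  [18881072091862663938, 4870591776282143425280, 4722583787075044180737],
  [4833698571825971659010, 74032338513821699, 18736952475608154881],
  [19170142490569474818, 4722582662248879358211, 74030122243457793],
  [4815035657156303258370, 18737801337323651331, 4741318761512003699457],
  [4889038520355852976896, 4778068698538025682690, 18447592926784586497],
  [18592838417193043456, 18592834001966596099, 4722872298930450727681],
  [4760055430313662676994, 315548583869981893142381312, 72060896918110977],
  [4760055146656842581504, 18592834006261301251, 18952560134515065601],
  [4907557322023600653058, 309518066531125135075836672, 72342367667291395],
  [72623859824002304, 4851637814296056102914, 4741320173289296035843],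
  [72342367667422209, 1218500112419239384776706, 72346782792876035],
  [4741318757131221337344, 18591703695356068610, 18664047162484457475],
  [4907413211250868617474, 4888966462761831760640, 18664048279108518657],
  [4722872013057511785728, 18953126374413631490, 18591709184391249923],
  [1256334530608756896825602, 18662923452943696131, 72907525166465793],
  [4796877140173095632898, 72902027608326913, 4778285437568677969923],
  [4814890414951595705600, 4833554456616286486530, 72628257769586691],
  [4741319044103705723650, 18736666602669211651, 18447589611036345088],
  [18952836112001073922, 315548583869981893092049665, 18520778589704618752],
  [1232704467904579150087683, 4870663833876181353217, 72903131364721408],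
  [4815035657160581515010, 4796444797885860545281, 18447588507279950592],
  [4907484705894953189378, 74035619784819456, 4741030811524218749697],
  [4814963599562198222594, 18449846925655081729, 18591704799112200960],
  [73472695718904578, 4759477274105771721219, 4741318760412492137217],
  [18810140406371844866, 4833338286050459517696, 4741319041904648717057],
  [18810140402076877570, 1218426182171077577408515, 18519650503642645249],
  [4889110863827293176578, 18880223260195356931, 4741318760429672006401],
  [18809295985770234114, 4851494255465175450369, 18519650512249421827],
  [1232630681490117473273344, 18736108076431179779, 18519652719879324417],
  [310727084803173890629502208, 72623842576630530, 74030122243719683],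
  [314349176786200609545126656, 4722582939338660839426, 19098084896531350273],
  [4889038243296220283906, 18951711294341906435, 72907546624525057],
  [1251612237024607634654210, 18591703695423242243, 72903148578013953],
  [4815179770158157071872, 18663485329155031809, 18591703716797218819],
  [1232630393257546593273344, 72623842576695299, 74880070518375169],
  [18808447162760232962, 18447588507347451907, 4741029963805031924481],
  [18809014497824736002, 4833338286033279648512, 4722583787075044180737],
  [4814963599566560297730, 72903131381497859, 4851927449848101470977],
  [319199084420988890855572226, 284777857024259, 18879935192477205249],
  [4814963599562265330434, 18591712508679225603, 4722872297813759296257],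
  [1251593861211098412680704, 74032338446712835, 18448722120981611265],
  [18520780823155115520, 74034520289968643, 4722872298930450727681],
  [4760055148838685966338, 18952277560093836032, 4815251824436479853313],
  [4815251826652683372032, 18952837194248749059, 18664329754085163777],
  [4722585197761398245120, 4833480137313962098690, 4815179766842441925377],
  [18953121980729000704, 18521910012956444163, 4741030812623730377473],
  [4814962469247048418816, 18590862560370753539, 18810140389124604673],
  [314339658050371662014186240, 18808447145496281858, 18880781803613259521],
  [4815179771257735807234, 309499251359107492473733888, 4907485264429562528513],
  [4796805083678569332738, 18736389551391113475, 4907557322023600456449],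
  [1251630611711065764333056, 18736389551391113475, 4796877142354871452417],
  [4888965904227205644546, 18880781803612995843, 4741030811511317136129],
  [320407991865915919305213440, 18520776412156264451, 19170427264097583873],
  [4740958190976000001537, 72060896918372867, 4796586650266037781248],
  [4760055430317957644546, 314344380416568645784765185, 72342367599919872],
  [1213685586530896980673794, 72060914148507651, 18951711294325129984],
  [1218574190165782319005954, 18447597316291888897, 284777856893696],
  [4907628821070144145154, 1213759082738043284751105, 18519648291751265024],
  [4907557322023617495810, 310727010797202350131970817, 72060914115217152],
  [18447598420132038144, 72060909870514179, 4814890411635796673281],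
  [18593967624191017730, 4796443667596497257216, 4814962469251359834881],
  [4723161660695561831936, 72060914165219331, 18519650503642645249],
  [4759766072938092495106, 18448718813806657795, 4741318761529250743041],
  [19242484871071073283, 4851494255448029201153, 1232630681485723654356994],
  [18880781807925002498, 4814890416068270031616, 4741029687801927697667],
  [1213704177391262572676352, 18591708093402383106, 284777857155587],
  [1237371205636770828320770, 1242000975857281407189760, 18447589628299969281],
  [1208963220043629288948737, 4907628253704796438530, 284795087290371],
  [1218574189884307342296066, 281487861809411, 4759765505602960294657],
  [4759766916267805967616, 1223166852131664406183938, 72907538118606851],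
  [4759766063055288468226, 315548583869986295484187137, 72060914115217152],
  [4796515728476219049472, 284790809296899, 4796443667562087121665],
  [1218444702952995948921602, 1208962930687357457793792, 18664329736905360129],
  [1209129384860982603875840, 284795104002051, 18448722095161541377],
  [4851495385754623213826, 72065316389323011, 4759476147097746604801],
  [1209129384579507627165184, 74884481500315907, 4796515725156125049601],
  [19170427264080872194, 4796516855479898473216, 4722582943728218146051],
  [18592834006261629954, 1232648548669504702448385, 72342371962322947],
  [18880786214527435267, 18447592918278931457, 1213777674723192025055234],
  [18592834006261629954, 1227926182186635057234689, 72342389125218307],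
  [4759766350015022695936, 1237370915152391510819585, 72342371962257411],
  [18592835101478290688, 1242019568409803900518402, 18519651611828158467],
  [284777856893696, 1218426543026395750268930, 18520781905436542721],
  [1213777891179669714502912, 72906425654903554, 72623846939033603],
  [4833337160146274812674, 4870519718688122209024, 18952560134582240001],
  [1208981520142538650354689, 19169298052704043010, 72623846938771459],
  [1237445280846736058155266, 72065299209453827, 18952278659605529345],
  [1237408387642258344051968, 4777996642030564081666, 18592835105756217347],
  [4760054297820981035266, 4814891541959553385216, 18663204932282483971],
  [4741246706134202712834, 18447594004838351363, 18447589611036345088],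
  [4741031658148239704322, 1232611655742116702847745, 18808724192344736512],
  [4870663556816548659458, 4741318761512003699456, 4796877142354854740737],
  [4796588913086871963394, 1218389216909023038669569, 72623846871532288],
  [4796877140173078855938, 18520779693494371072, 4814890411661600031489],
  [4796515729588632225283, 18449852418918253313, 18591704799112200960],
  [72069736095285506, 18448721012913995779, 4796515725160419951361],
  [18738082812333916930, 4777996073596021113600, 4741030531148753732353],
  [19025750242860793858, 19170145789154690051, 1209055307118816241124097],
  [4722583218631894892802, 73191220591067395, 1242075270335183980593921],
  [18738082803743982338, 1241982529399102162141953, 18519646122759290883],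
  [1232611946513477178689024, 72060914098110467, 18519650520822514433],
  [310722344134341411287270656, 72623842576630530, 72907525166727683],
  [1242093353974330170671872, 1208981232475108072947714, 18521904519709721345],
  [4723161659608935106048, 4741031092990656053507, 18882197983145820929],
  [4833553607789132580352, 72342376139653379, 19026312076005016321],
  [4796733026084447520256, 4777852244280951702273, 18591703716797218819],
  [1232611946513472883721728, 72623842576695299, 75160446000169729],
  [18736389551525528322, 72060892623208963, 1213703670734105419514625],
  [4814891541976817337090, 4777996079093512143616, 4722872297830939165441],
  [4815179770158240956418, 18880790629770919939, 4722582663352668914433],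
  [4796947787067911766274, 72342371894952195, 4851639220575789908737],
  [4796516855488539067138, 18881916508219703299, 4814890411640091575041],
  [1232686020311665183491584, 284795036893187, 18447592926784586497],
  [18736108093728818178, 18880786214510920195, 4722872298930450727681],
  [18882198000342401794, 4741318760429739049728, 4889038520355869688577],
  [4796805082578973820416, 4741029693312370606339, 4815035657147629241089],
  [18664333069833930496, 1237370915152391426998274, 4815179771240488436481],
  [4870519160153496093698, 74884464320512003, 4741319043004160279297],
  [4741318760429756089346, 72628270654423043, 18521910012956181249],
  [310727140141712872441250817, 284773561991938, 18592836188104949763],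
  [18810140406304473858, 4741318760429739049728, 4833410343627300864769],
  [4796444797898796106498, 18519651607466082563, 4833482401221338792705],
  [1256297637120609477722370, 72902031886778627, 4778067573733335302913],
  [4870519160153496158210, 4777707285763145663233, 72906438539870211],
  [315567621345031781542725120, 284773562056707, 18593966511777448705],
  [4740959316871611876610, 72060896985612291, 4722872575990167634688],
  [4759478402221949255938, 310726992350739747104097025, 72342367599919872],
  [1213703960935901675586818, 72060914148507651, 18664326442615177984],
  [4759477271928257185538, 1218463076509151830082305, 72342371894821632],
  [1232722914367177899706114, 18592837287532299008, 4814890411653010162433],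
  [1232630102489493360018945, 4759621951135699566595, 284773561991936],
  [74038935583917568, 18736389551458353667, 4796515725160419951361],
  [1213685659153665798635522, 18448726527634899712, 310703380879735983257420545],
  [18953690428257797632, 18448719917697073155, 18952560117335196417],
  [74040047963276032, 1209055091223106829681409, 18519648296113602563],
  [4815323886445811532803, 18951149435343602433, 1232704468181638749290498],
  [18809010104039506688, 1208981520701069081969409, 72342376156430339],
  [1213704177109787595965696, 18736389551542239747, 18592831785696035586],
  [1112396727555, 315553306236183292122628864, 1208981233599904173195266],
  [1208981234724708964303873, 18737519862347005955, 4760054301119398215682],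
  [4759764942648661508866, 309518084977587738120684288, 73187922173822211],
  [4777781592949434811393, 18809295981408157955, 1237426833538612765851650],
  [1218499824193269902934786, 1242000975857298570609408, 18736108093745399043],
  [18809013385445180928, 73472695635018243, 4796443667566382023425],
  [310722362364916022942892802, 18449846925655081728, 1213685080430084087612161],
  [4926003786808522376704, 72907538101895171, 18736952475608154881],
  [1232611656872423363903746, 284790725214467, 18591703699633996545],
  [4925931447748097672704, 19169864314178043907, 4741318761512003699457],
  [19098369670059655936, 72060901179719683, 4778067569326698922753],
  [4741029684516277913088, 18591709192913945091, 4796515725173338538753],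
  [1237371205917146293403906, 18519646122809557760, 1227870770178290572329729],
  [1218426471815438668334592, 18592835105772929027, 18952559035070546689],
  [4759766064154800030466, 314344380416568662931407616, 72342367667291395],
  [18592834001966662912, 4833263127799204610050, 18520777511718289411],
  [4759765785978425312000, 1218426253666825518842625, 282587390214147],
  [1213777601825579777590273, 74030117948556034, 72623846871794179],
  [310722417993097149575135234, 18449851323701592832, 1213685080430084087612161],
  [1208981520142534355387393, 19241074176043450370, 72623846938771459],
  [4796515448126557127683, 1218537367607134184996866, 72907525166465793],
  [1218574045486553368036608, 18664049365701820418, 18591709205866086403],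
  [1213851679003683722822912, 4907556477590013411330, 283686901841923]]

/-- Trees for `unsolved (candidates 5)`. -/
def treesFive : List (List ℕ) := [
  [4796729924327819117569, 320403121780236090712589314, 1355332171551790528703070634175168772,
    311902935465694845689462787],
  [19098927126817407748, 79848360497200569668738548739, 5192534854944324768616211422904322,
    315558213865280309452604160],
  [4888965896483329605891, 309527696311382175377326852, 5334831119190873919665092843143937,
    1261130684342786351694848],
  [310712825757101688447370243, 80786505822759512080457663234, 309523047803924398515159812,
    1246815866836295268434944],
  [79231813051417783201809301762, 314353862477623229447275523,
    1339775644478139548615842663929938945, 4741464005902866777088],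
  [79231831885688447599940469505, 4962824931493124703232, 4722582665607594379268,
    20362876953039607178353122214658],
  [320389157884616644998726402, 325257936031641587109004289, 20365674421682926207976433779712,
    20917793242296646201358741471235],
  [1251556752108725148846337, 79237862421258436400566567938, 313178048419227527119307776,
    5375395008729370483446644341933059],
  [5232862607448588129533563674559489, 80468558313537093418283696900,
    79547361543056292123892974595, 316776602936378645845114882],
  [1246852614223515070301187, 81091159869825981219093086978, 5192535784612947078236315461092097,
    320417528687639124225819392],
  [313116676533474723711484674, 1251538233029976176263427, 79231822459620078744521670916,
    324058380723419038412375041],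
  [317980805957163758798439426, 340298065984141779233596034312259044609, 18735823285756691459,
    81404257508887224089703481348],
  [315553398614018865842291713, 4888603355630994522371, 20521654876022205083315536593156,
    324049028801479927184688130],
  [309527770314527979581473028, 21236566443486749470890794353666, 4723378958290838094593,
    4981417198147057418243],
  [319180194881307665512924161, 79541316914246172294437208834, 1242112161567116477661443,
    83576730318640042450840978176],
  [1208999823895116628164867, 324049010426510877353247236, 1251482460729254781125377,
    316767065176494992863527936],
  [4981560759181255902208, 342946300037718069805025526977405125377, 311940806847741215874745090,
    4815179212692893598723],
  [19386034897301799684, 19097523033221956099, 342966886843160031836693145832489485057,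
    20441794426229553193749690975234],
  [1232667358241420411732995, 319175417175716275656655361, 79548551616447013456659874308,
    20443350290221785814559703171584],
  [1228055744277318675791875, 82644634344980256704331711489, 319194269241507942844531714,
    311945492463715356552661248],
  [20760573662715065136841358903297, 20839185291950791941714289557506,
    20680113623624523017473040253188, 1213722695910347124179968],
  [313116584156484674198373376, 81097223407633028136797732868, 1237426617364765651566595,
    80474598331310568625444225026],
  [4888965896487540425731, 5294584761281714825282679459611649, 311917102491405823949144836,
    314334972867860219509867264],
  [1270575417308512690308096, 20680114832532111220792459527169, 82022023306704065213361423106,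
    4741101460665420810499],
  [20285208319055589518211081830659, 79850802071641188473550471170, 4870375324219848785924,
    313135473115762281376973825],
  [81403057990981400848526148610, 18666023014961054723, 5192932237342565333789243833648129,
    1223111584523268758439172],
  [1218426543871941767660292, 311907640035649655259988993, 5192536407252356231197820545401602,
    4815179212680075608067],
  [316767139686304546894185217, 311902917450745498078348036, 79851996700730307968432669442,
    81710111000437624227540566275],
  [80479452887523737560129012739, 310708269337570129161159682, 79245125347339131913754575108,
    311921954853163838696653569],
  [315562843639164427152392708, 80156636525574683039711167233, 325253231965815057796038658,
    310736659240938096614965763],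
  [18735825506372485123, 5192932856336289476646313121547266, 1232648911221408038978308,
    20601813892435295166494606426881],
  [4870230083144750859267, 20759953478936050347969356170242, 21077799438708127720858356089601,
    4888965896483245523716],
  [4888604766325904179203, 1246797635973620206665988, 5233102150036318510637534222549761,
    1251482820179431469875968],
  [321640529372420151852663044, 20441805273487350789079776297985, 1213722768817902456471555,
    80161491099727932268164088834],
  [4815035097504868008963, 80467349405877684622126482433, 1334481617102992040809791961553765122,
    21395334661820677053360667558912],
  [4963186631244784010242, 79237862513852444739253765120, 345599360668162034899462773652364394756,
    4889255262715122352387],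
  [1213703600936003549268225, 80165113248063662227194184706, 1256353411389452206539779,
    82644653234374130588874703616],
  [20364126991911379817360074736385, 4833987645518834238464, 315572307034768841579560963,
    311907731763840957096002308],
  [4888603643711546721024, 310712881099311952435544324, 79858036626197153074400069379,
    20681031136783198259878465438465],
  [318004418223338755719168770, 79540065431715364566599074564, 79233036089143273711217214467,
    1256390304869868735300608],
  [1334481616805653050031721119511478784, 313111953736900288608535043, 1223259445580364744033282,
    1218426541893898874389252],
  [1344825331565326451819404366474117633, 20920581048941177432670411490050,
    20680108787902869876866243887363, 313121306377160228981965060],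
  [79850759477891261741370901506, 5212896196551980578171711712920321, 4796516290339562651651,
    1223112014610448987455748],
  [79850778237726417178918454275, 81098437055818849666872902400, 1223204323778244593058052,
    320379528322508226419688450],
  [19096106862211564547, 20283657243542610788985499288578, 20601804225806516740662437151489,
    313111935290436590363738884],
  [4777995235755192156164, 5334751585188906222405244080947202, 311917213968160780558795776,
    1246797709725600318030083],
  [321640529300360363187045377, 79541302765883110990540899330, 319180139541638360028741635,
    1251538233029976092181252],
  [1227870626907536016737283, 5233497674301444195340886743384322, 310731825687888889622102788,
    20521341721548365064674226733825],
  [4888603354531482894595, 81714965482356306476276121860, 79231812996800382036689355522,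
    5233102470425346327903804777038593],
  [5233259691247132376316708179280131, 20285211941110609821630644617986, 1223259589123785164784388,
    320379638786520584739292161],
  [20918103969399965354423255958273, 1246778972215650805743620, 320379620412397063695303426,
    20839190099153344716527861235971],
  [320379528250170256916677633, 81714989186422163033871680514, 20283653616802478352797725557763,
    5212819750132500047050195949585408],
  [5213691570623518592307324443165440, 80786505767275722119303070722, 1223259155935990802088708,
    5335386029445002153086313650193153],
  [319194269099642351314535170, 1227963148293157559796484, 5192458108715907638750045408919811,
    20838560267838655298034859181056],
  [20759652475370507737058507227394, 1334481144217188404681400633805505025,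
    81403062823882536426045702404, 4778356080065515159555],
  [315567547413378478302036228, 79547347376099553535695455234, 20521332050160686392840967684864,
    311921898644576907779310595],
  [313159233174593764527178754, 81093572981087151583520098304, 79230618237720201811770998788,
    322844751272293786169115393],
  [4796732176119093526532, 316781232854380172152144641, 83262371697409956409353240579,
    79852006053011688404405126146],
  [1209092274349022498062595, 4815179203875308897028, 20443659770416644417736872821504,
    1275186958370642736645121],
  [1218426183016593563844612, 314344491891079529260844032, 20680418249171009327687778305026,
    20680418249170937543854821409793],
  [313111861284748745324430336, 20443659794102049605909842428420, 320431603264288156828238082,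
    309546604296390203773486081],
  [81095990795615868830005592834, 81404266861749014723779691520, 314320953270026235076149252,
    1237352903287135395186179],
  [1232630536526106403865603, 20362583212418012157568960627713, 1213722551797366796126464,
    81403081695190235677767303426],
  [80782879063963580655072772864, 19096106862211564292, 20918409804075403043148361433090,
    310731825689301770586752003],
  [310731807313486066771099651, 20364119724096838480634929480450, 79540065542324321153318322948,
    1275187174259746572337920],
  [5233497674301462642371950268383491, 310712973114601116317253636, 317990158455563600837935106,
    83268458975379479165896164352],
  [5273585892619269990590296923308291, 1246852615075662418805762,
    5192535790676410230232599775675393, 310736529750612554189112580],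
  [317985473415763274389128192, 317980695275573438226890756, 20362879356761180899856292643843,
    20364119724060307248579201926145],
  [1251593354838727656211202, 80161491137125823595290034944, 5294107534154514140059015458128644,
    79547352098538938432881755139],
  [314335046581653007568536321, 81092364055412498744664589314, 309503955278278931803079428,
    4944596058959945729027],
  [4963042516065381975042, 20362876971984699886886247793155, 1334481459260824995961266810031965184,
    1227870914580489888595972],
  [324049010426511972553065475, 4722585198848058589188, 1227926688847125054751745,
    82017154436105732027431518976],
  [74606296485135363, 5192534553907480648915122628133890, 20286758157233681045444710433792,
    311907639457505537904082948],
  [319194269099360876354536450, 5314389942539720462398133463352320, 309518196163873725873193987,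
    314358565819209124717921028],
  [320379527961656198141510657, 5334830812142494594510980156228352, 81091178852320808706083653890,
    313135510444122688008094723],
  [320389065289472493452723202, 1360544592677920025689323650917991169, 311940862404424421463359491,
    4870228669142665659140],
  [311940769808160967146865412, 5274301113742820023780938638427394,
    20996391540218003196767098766337, 79541293283677372814324728835],
  [1334684918123933821960498334902256640, 1251482820178327680057860, 320398546915644883727352833,
    1246778613050281987998466],
  [4759478687021247496452, 1329512744907997867306606112041665282, 1251538159567223457317888,
    4759551875995553235971],
  [310708214433625238675915520, 5294107224693226689166403229188866, 4759550468616391492611,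
    72917446641976068],
  [79546166858700701179639628803, 20362574726178013161932525142529, 4944666703672868340482,
    317971250472247768115579136],
  [80157840710579381854179296256, 5477046292301276405564799155634435, 1251593355120181208351236,
    20283348991181627753392926360322],
  [316800196250271727575302148, 4833409783984539698179, 314382270246481734169330432,
    5212739280388909848306542987904002],
  [1223112377442727755317507, 80472175683878449630513726209, 1237352830960208269673220,
    1251482819896857032066048],
  [82648256288742226463579243264, 313140343852214489658688514, 1218444555743799416326148,
    20602738725520563196419411018497],
  [20364430422754991160991888442112, 1246778539581993090483203,
    1334501423211562393428756517844157186, 309499269517338615644029700],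
  [20283653612079750171263030854402, 20362885406131093611709743760128, 1218537078525731873030403,
    1246778612772092745220868],
  [1251482819896857082266368, 20362573503250753665174572368897, 4815179203875308897283,
    320398546915368940735890180],
  [83262371678962077630952898562, 81403058009716088291559735811, 81094786591946851265208648448,
    1270575561986663671660804],
  [1213796122874632162771204, 1246890229986361201655811, 5273508527449407368437908390478849,
    81405480546032020688252109826],
  [311917195157748833722106115, 313135565711464997698470660, 5192615641430999446350453480292610,
    79541298117301348230758466560],
  [5253622877609438531568978989417474, 1237408242678290258132995, 1227963149426754048033540,
    1339734841351781606986509583032255489],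
  [1256334962950996702200068, 20760889211225075801115722974209, 80159063858984197681682908162,
    4741103719014975210499],
  [309504047224623262014701571, 20521648807817877882168456446978, 311921898644858365609771780,
    1246778972216750334280448],
  [5212897736714011803664531379520514, 19024331842662040579, 309522973944898210515452676,
    79554624616999737967937585921],
  [21157335877306393787796216677120, 320389102254456397453329409, 4778357770010575241476,
    79850801849992031411857064706],
  [79542530636219247187472876544, 80161462692029723991253123588,
    5192537654859079491123151116501761, 1227907954155223894918147],
  [4870228674657487355908, 1251482820179431469876227, 314335009833400441984058114,
    20285207105407403420712362312449]]

theorem certifiesAll_four : certifiesAll 4 [0, 1, 2, 3]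
    (forceWords (candidates 4) (triples (before 4))) treesFour = true := by
  decide +kernel

theorem certifiesAll_five : certifiesAll 5 [0, 1, 2, 3, 4] (unsolved (candidates 5)) treesFive =
    true := by
  decide +kernel

end Tables

section Main

theorem exists_eq_of_card_eq_three {α β : Type*} [LinearOrder β] (f : α → β) {S : Finset α}
    (hS : S.card = 3) (hf : Set.InjOn f S) :
    ∃ a b c, f a < f b ∧ f b < f c ∧ (S : Set α) = {a, b, c} := by
  classical
  obtain ⟨x, y, w, hxy, hxw, hyw, rfl⟩ := Finset.card_eq_three.mp hS
  have h1 : f x ≠ f y := fun h => hxy (hf (by simp) (by simp) h)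
  have h2 : f x ≠ f w := fun h => hxw (hf (by simp) (by simp) h)
  have h3 : f y ≠ f w := fun h => hyw (hf (by simp) (by simp) h)
  simp only [Finset.coe_insert, Finset.coe_singleton]
  rcases lt_or_gt_of_ne h1 with h1 | h1 <;> rcases lt_or_gt_of_ne h2 with h2 | h2 <;>
    rcases lt_or_gt_of_ne h3 with h3 | h3
  · exact ⟨x, y, w, h1, h3, rfl⟩
  · exact ⟨x, w, y, h2, h3, by grind⟩
  · exact absurd (h2.trans h1) h3.asymm
  · exact ⟨w, x, y, h2, h1, by grind⟩
  · exact ⟨y, x, w, h1, h2, by grind⟩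
  · exact absurd (h3.trans h1) h2.asymm
  · exact ⟨y, w, x, h3, h2, by grind⟩
  · exact ⟨w, y, x, h3, h1, by grind⟩

theorem Separated.exists_sorted {n : ℕ} (hn : 4 ≤ n) {S : Finset (Equiv.Perm (Fin n))}
    (hS : S.card = 4) (hsep : Separated (S : Set (Equiv.Perm (Fin n)))) :
    ∃ z a b c : Equiv.Perm (Fin n), (S : Set (Equiv.Perm (Fin n))) = {v | v ∈ [z, a, b, c]} ∧
      [word (z⁻¹ * a), word (z⁻¹ * b), word (z⁻¹ * c)].Pairwise (fun x y => before n x y = true) ∧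
      ∀ x ∈ [word (z⁻¹ * a), word (z⁻¹ * b), word (z⁻¹ * c)], x ∈ candidates n := by
  classical
  obtain ⟨z, hz⟩ : S.Nonempty := Finset.card_pos.mp (by omega)
  have hinj : Set.InjOn (fun v => (z⁻¹ * v) ⟨n - 1, by omega⟩)
      (S : Set (Equiv.Perm (Fin n))) := fun u hu v hv h =>
    hsep u hu v hv ⟨n - 1, by omega⟩ (by simp only; omega) (z⁻¹.injective h)
  obtain ⟨a, b, c, hab, hbc, hE⟩ := exists_eq_of_card_eq_three _
    (by rw [Finset.card_erase_of_mem hz, hS] : (S.erase z).card = 3)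
    (hinj.mono (Finset.coe_subset.mpr (Finset.erase_subset z S)))
  have hmem : ∀ v : Equiv.Perm (Fin n), v ∈ S.erase z ↔ v = a ∨ v = b ∨ v = c := fun v => by
    rw [← Finset.mem_coe, hE]
    simp
  have hlast : ∀ v ∈ S.erase z,
      (z⁻¹ * v) ⟨n - 1, by omega⟩ < (z⁻¹ * z) ⟨n - 1, by omega⟩ := by
    intro v hv
    rw [Finset.mem_erase] at hv
    refine lt_of_le_of_ne ?_ fun h => hv.1 (hinj hv.2 hz h)
    rw [inv_mul_cancel, Equiv.Perm.one_apply, Fin.le_def]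
    simp only
    omega
  have ha := (hmem a).mpr (by simp)
  have hb := (hmem b).mpr (by simp)
  have hc := (hmem c).mpr (by simp)
  have haS := Finset.mem_of_mem_erase ha
  have hbS := Finset.mem_of_mem_erase hb
  have hcS := Finset.mem_of_mem_erase hc
  refine ⟨z, a, b, c, ?_, ?_, ?_⟩
  · ext v
    simp only [Finset.mem_coe, Set.mem_ofPred_eq, List.mem_cons, List.not_mem_nil, or_false,
      ← hmem, Finset.mem_erase]
    by_cases h : v = z <;> simp [h, hz]
  · simp only [List.pairwise_cons, List.mem_cons, List.not_mem_nil, or_false, forall_eq_or_imp,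
      forall_eq]
    exact ⟨⟨before_word hn hsep haS hbS hab, before_word hn hsep haS hcS (hab.trans hbc)⟩,
      before_word hn hsep hbS hcS hbc, by simp⟩
  · simp only [List.mem_cons, List.not_mem_nil, or_false, forall_eq_or_imp, forall_eq]
    exact ⟨word_mem_candidates hn hsep hz haS (hlast a ha),
      word_mem_candidates hn hsep hz hbS (hlast b hb),
      word_mem_candidates hn hsep hz hcS (hlast c hc)⟩

theorem exists_isIDSTFamily_four {z a b c : Equiv.Perm (Fin 4)}
    (hb : [word (z⁻¹ * a), word (z⁻¹ * b), word (z⁻¹ * c)].Pairwise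
      (fun x y => before 4 x y = true))
    (hc : ∀ x ∈ [word (z⁻¹ * a), word (z⁻¹ * b), word (z⁻¹ * c)], x ∈ candidates 4) :
    ∃ T : Fin (4 - 1) → (godanGraph 4 (by omega)).Subgraph,
      IsIDSTFamily (godanGraph 4 (by omega)) {v | v ∈ [z, a, b, c]} T := by
  simp only [List.pairwise_cons, List.mem_cons, List.not_mem_nil, or_false, forall_eq_or_imp,
    forall_eq] at hb hc
  have h := certifiesAll_four
  rw [forceWords_eq] at h
  obtain ⟨Ns, hNs⟩ := exists_certifies h
    (mem_triples hc.1 hc.2.1 hc.2.2 hb.1.1 hb.1.2 hb.2.1)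
  refine exists_isIDSTFamily_of_certifies (by omega) (fun i hi => word_mul_gen_four hi.le)
    (Ns := Ns) ?_
  rw [inv_mul_cancel, word_one]
  exact hNs

theorem exists_isIDSTFamily_five {z a b c : Equiv.Perm (Fin 5)}
    (hS : Separated {v | v ∈ [z, a, b, c]})
    (hb : [word (z⁻¹ * a), word (z⁻¹ * b), word (z⁻¹ * c)].Pairwise
      (fun x y => before 5 x y = true))
    (hc : ∀ x ∈ [word (z⁻¹ * a), word (z⁻¹ * b), word (z⁻¹ * c)], x ∈ candidates 5) :
    ∃ T : Fin (5 - 1) → (godanGraph 5 (by omega)).Subgraph,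
      IsIDSTFamily (godanGraph 5 (by omega)) {v | v ∈ [z, a, b, c]} T := by
  simp only [List.pairwise_cons, List.mem_cons, List.not_mem_nil, or_false, forall_eq_or_imp,
    forall_eq] at hb hc
  by_cases h : [word (z⁻¹ * a), word (z⁻¹ * b), word (z⁻¹ * c)] ∈ unsolved (candidates 5)
  · obtain ⟨Ns, hNs⟩ := exists_certifies certifiesAll_five h
    refine exists_isIDSTFamily_of_certifies (by omega) (fun i hi => word_mul_gen_five hi.le)
      (Ns := Ns) ?_
    rw [inv_mul_cancel, word_one]
    exact hNs
  · obtain ⟨p, hp, hpair⟩ := exists_unblocked hc.1 hc.2.1 hc.2.2 hb.1.1 hb.1.2 hb.2.1 h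
    have hchoices : ∀ p ∈ choices, 3 ≤ (p.1 : ℕ) ∧ 3 ≤ (p.2.1 : ℕ) ∧ p.1 ≠ p.2.1 := by
      decide +kernel
    obtain ⟨hm, hk, hmk⟩ := hchoices p hp
    refine exists_isIDSTFamily_of_unblocked (z := z) hS hm hk hmk (c := p.2.2) ?_
    rw [List.map_cons, inv_mul_cancel, word_one]
    exact hpair

end Main

/-- Let n ≥ 4 and let S be a set of four distinct vertices of EA_n such that for
every position m with 4 ≤ m ≤ n and every symbol i, at most one vertex of S has
m-th symbol i (positions and symbols 0-based: position m has index m − 1). Then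
there exist n − 1 pairwise internally edge disjoint S-trees in EA_n. -/
theorem IDSTs_all_separate (n : ℕ) (hn : 4 ≤ n)
    (S : Finset (Equiv.Perm (Fin n))) (hS : S.card = 4)
    (hsep : ∀ (m : ℕ) (hm4 : 4 ≤ m) (hmn : m ≤ n) (i : Fin n),
      (S.filter (fun σ => σ (⟨m - 1, by omega⟩ : Fin n) = i)).card ≤ 1) :
    ∃ T : Fin (n - 1) → (godanGraph n (by omega)).Subgraph,
      IsIDSTFamily (godanGraph n (by omega)) (↑S : Set (Equiv.Perm (Fin n))) T := by
  have hsep' : Separated (S : Set (Equiv.Perm (Fin n))) := by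
    intro x hx y hy k hk hxy
    have hk' : (⟨(k : ℕ) + 1 - 1, by omega⟩ : Fin n) = k := Fin.ext (by simp)
    refine Finset.card_le_one.mp (hsep (k + 1) (by omega) (by omega) (y k)) x ?_ y ?_ <;>
      rw [Finset.mem_filter, hk']
    exacts [⟨hx, hxy⟩, ⟨hy, rfl⟩]
  obtain ⟨z, a, b, c, hE, hb, hc⟩ := hsep'.exists_sorted hn hS
  rw [hE] at hsep' ⊢
  rcases Nat.lt_or_ge n 7 with h7 | h7
  · obtain rfl | rfl | rfl : n = 4 ∨ n = 5 ∨ n = 6 := by omega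
    · exact exists_isIDSTFamily_four hb hc
    · exact exists_isIDSTFamily_five hsep' hb hc
    · have hset : {v | v ∈ [z, a, b, c]} = ({z, a, b, c} : Set (Equiv.Perm (Fin 6))) := by
        ext v
        simp
      rw [hset] at hsep' ⊢
      exact exists_isIDSTFamily_six hsep'
  · exact exists_isIDSTFamily_seven_le h7 hsep'

end Godan
end

section
/- For every n ≥ 3, the connectivity of the godan graph EA_n equals n: for every set W of fewer than n vertices, the subgraph of EA_n induced on V(EA_n) \ W is connected (and has at least two vertices), and there exists a set of n vertices whose deletion leaves EA_n disconnected. -/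
namespace Godan

open Equiv

/-- If every pair of a family of pairwise disjoint pairs `{e k, f k}` meets `S`, then `S` has at
least as many elements as the family. -/
lemma card_le_ncard_of_forall_mem_or_mem {ι V : Type*} [Finite V] (K : Finset ι) (S : Set V)
    (e f : ι → V) (he : ∀ k ∈ K, ∀ l ∈ K, e k = e l → k = l)
    (hf : ∀ k ∈ K, ∀ l ∈ K, f k = f l → k = l) (hef : ∀ k ∈ K, ∀ l ∈ K, e k ≠ f l)
    (h : ∀ k ∈ K, e k ∈ S ∨ f k ∈ S) : K.card ≤ S.ncard := by
  classical
  rw [← Set.ncard_coe_finset K]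
  refine Set.ncard_le_ncard_of_injOn (fun k ↦ if e k ∈ S then e k else f k) ?_ ?_ S.toFinite
  · intro k hk
    have := h k hk
    split_ifs with h1
    · exact h1
    · exact this.resolve_left h1
  · intro k hk l hl hkl
    dsimp only at hkl
    split_ifs at hkl
    · exact he k hk l hl hkl
    · exact absurd hkl (hef k hk l hl)
    · exact absurd hkl.symm (hef l hl k hk)
    · exact hf k hk l hl hkl

section Connectivity

variable {n : ℕ}

/-- `u` and `v` survive the deletion of `W` and are joined by a walk avoiding `W`. -/
def Joined (hn : 3 ≤ n) (W : Set (Perm (Fin n))) (u v : Perm (Fin n)) : Prop :=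
  ∃ (hu : u ∈ Wᶜ) (hv : v ∈ Wᶜ), ((godanGraph n hn).induce Wᶜ).Reachable ⟨u, hu⟩ ⟨v, hv⟩

namespace Joined

variable {hn : 3 ≤ n} {W : Set (Perm (Fin n))} {u v w : Perm (Fin n)}

lemma refl (hu : u ∉ W) : Joined hn W u u := ⟨hu, hu, .refl _⟩

lemma symm (h : Joined hn W u v) : Joined hn W v u :=
  let ⟨hu, hv, h⟩ := h
  ⟨hv, hu, h.symm⟩

lemma trans (h : Joined hn W u v) (h' : Joined hn W v w) : Joined hn W u w :=
  let ⟨hu, _, h⟩ := h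
  let ⟨_, hw, h'⟩ := h'
  ⟨hu, hw, h.trans h'⟩

lemma of_mem_omegaStar {s : Perm (Fin n)} (hs : s ∈ OmegaStar n hn) (hu : u ∉ W)
    (hv : u * s ∉ W) : Joined hn W u (u * s) := by
  by_cases h : u = u * s
  · rw [← h]
    exact refl hu
  · refine ⟨hu, hv, SimpleGraph.Adj.reachable ?_⟩
    simp only [godanGraph, SimpleGraph.comap_adj, SimpleGraph.fromRel_adj,
      Function.Embedding.subtype_apply]
    exact ⟨h, .inr ⟨s, hs, rfl⟩⟩

end Joined

lemma perm12_mem (hn : 3 ≤ n) : perm12 n hn ∈ OmegaStar n hn := by simp [OmegaStar]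

lemma perm123_mem (hn : 3 ≤ n) : perm123 n hn ∈ OmegaStar n hn := by simp [OmegaStar]

lemma perm132_mem (hn : 3 ≤ n) : perm132 n hn ∈ OmegaStar n hn := by simp [OmegaStar]

lemma perm12_mul_swap_mem (hn : 3 ≤ n) {k : Fin n} (hk : 3 ≤ (k : ℕ)) :
    perm12 n hn * swap ⟨2, by omega⟩ k ∈ OmegaStar n hn :=
  .inr ⟨k, hk, rfl⟩

lemma perm12_apply_of_two_le (hn : 3 ≤ n) {k : Fin n} (hk : 2 ≤ (k : ℕ)) :
    perm12 n hn k = k :=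
  swap_apply_of_ne_of_ne (by grind) (by grind)

lemma perm12_mul_self (hn : 3 ≤ n) : perm12 n hn * perm12 n hn = 1 := swap_mul_self _ _

lemma perm123_mul_perm132 (hn : 3 ≤ n) : perm123 n hn * perm132 n hn = 1 := by
  simp [perm123, perm132, mul_assoc]

lemma perm132_mul_perm123 (hn : 3 ≤ n) : perm132 n hn * perm123 n hn = 1 := by
  simp [perm123, perm132, mul_assoc]

lemma perm123_mul_self (hn : 3 ≤ n) : perm123 n hn * perm123 n hn = perm132 n hn := by
  ext x
  simp only [perm123, perm132, Perm.mul_apply, swap_apply_def]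
  grind

lemma perm12_mul_perm132 (hn : 3 ≤ n) :
    perm12 n hn * perm132 n hn = perm123 n hn * perm12 n hn := by
  simp [perm12, perm123, perm132, mul_assoc]

lemma perm12_mul_perm123 (hn : 3 ≤ n) :
    perm12 n hn * perm123 n hn = perm132 n hn * perm12 n hn := by
  simp [perm12, perm123, perm132, mul_assoc]

lemma perm123_apply_two (hn : 3 ≤ n) : perm123 n hn ⟨2, by omega⟩ = ⟨0, by omega⟩ := by
  simp only [perm123, Perm.mul_apply, swap_apply_def]
  grind

lemma perm132_apply_two (hn : 3 ≤ n) : perm132 n hn ⟨2, by omega⟩ = ⟨1, by omega⟩ := by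
  simp only [perm132, Perm.mul_apply, swap_apply_def]
  grind

lemma perm123_apply_of_three_le (hn : 3 ≤ n) {k : Fin n} (hk : 3 ≤ (k : ℕ)) :
    perm123 n hn k = k := by
  simp only [perm123, Perm.mul_apply, swap_apply_def]
  grind

lemma perm12_mul_swap_apply_two (hn : 3 ≤ n) {k : Fin n} (hk : 2 ≤ (k : ℕ)) :
    (perm12 n hn * swap ⟨2, by omega⟩ k) ⟨2, by omega⟩ = k := by
  rw [Perm.mul_apply, swap_apply_left, perm12_apply_of_two_le hn hk]

lemma perm12_mul_swap_apply_right (hn : 3 ≤ n) (k : Fin n) :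
    (perm12 n hn * swap ⟨2, by omega⟩ k) k = ⟨2, by omega⟩ := by
  rw [Perm.mul_apply, swap_apply_right, perm12_apply_of_two_le hn le_rfl]

lemma perm12_mul_swap_apply_of_lt (hn : 3 ≤ n) {k l : Fin n} (hl : 3 ≤ (l : ℕ)) (hkl : k < l) :
    (perm12 n hn * swap ⟨2, by omega⟩ k) l = l := by
  rw [Perm.mul_apply, swap_apply_of_ne_of_ne (by grind) (by grind),
    perm12_apply_of_two_le hn (by omega)]

lemma inv_mem_omegaStar {hn : 3 ≤ n} {s : Perm (Fin n)} (hs : s ∈ OmegaStar n hn) :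
    s⁻¹ ∈ OmegaStar n hn := by
  rcases hs with (rfl | rfl | rfl) | ⟨k, hk, rfl⟩
  · rw [inv_eq_of_mul_eq_one_right (perm12_mul_self hn)]
    exact perm12_mem hn
  · rw [inv_eq_of_mul_eq_one_right (perm123_mul_perm132 hn)]
    exact perm132_mem hn
  · rw [inv_eq_of_mul_eq_one_right (perm132_mul_perm123 hn)]
    exact perm123_mem hn
  · refine .inr ⟨k, hk, ?_⟩
    ext x
    simp only [perm12, mul_inv_rev, swap_inv, Perm.mul_apply, swap_apply_def]
    grind

/-- A generator is determined by the image of the third symbol, which is arbitrary. -/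
lemma bijOn_apply_two (hn : 3 ≤ n) :
    Set.BijOn (fun s : Perm (Fin n) ↦ s ⟨2, by omega⟩) (OmegaStar n hn) Set.univ := by
  refine ⟨fun _ _ ↦ Set.mem_univ _, ?_, ?_⟩
  · have h12 := perm12_apply_of_two_le hn (k := ⟨2, by omega⟩) le_rfl
    have h123 := perm123_apply_two hn
    have h132 := perm132_apply_two hn
    have hswap (k : Fin n) (hk : 3 ≤ (k : ℕ)) := perm12_mul_swap_apply_two hn (k := k) (by omega)
    rintro s ((rfl | rfl | rfl) | ⟨k, hk, rfl⟩) s' ((rfl | rfl | rfl) | ⟨l, hl, rfl⟩) h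
    all_goals
      dsimp only at h
      first
      | rfl
      | grind
  · intro k _
    by_cases hk : 3 ≤ (k : ℕ)
    · exact ⟨_, perm12_mul_swap_mem hn hk, perm12_mul_swap_apply_two hn (by omega)⟩
    · obtain h | h | h : (k : ℕ) = 0 ∨ (k : ℕ) = 1 ∨ (k : ℕ) = 2 := by omega
      · exact ⟨_, perm123_mem hn, (perm123_apply_two hn).trans (Fin.ext h.symm)⟩
      · exact ⟨_, perm132_mem hn, (perm132_apply_two hn).trans (Fin.ext h.symm)⟩
      · exact ⟨_, perm12_mem hn, (perm12_apply_of_two_le hn le_rfl).trans (Fin.ext h.symm)⟩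

lemma ncard_omegaStar (hn : 3 ≤ n) : (OmegaStar n hn).ncard = n := by
  have h := bijOn_apply_two hn
  rw [← h.injOn.ncard_image, h.image_eq, Set.ncard_univ, Nat.card_fin]

lemma one_notMem_omegaStar (hn : 3 ≤ n) : (1 : Perm (Fin n)) ∉ OmegaStar n hn := by
  intro h
  have h1 := (bijOn_apply_two hn).injOn h (perm12_mem hn)
    (perm12_apply_of_two_le hn le_rfl).symm
  have h2 := congr($h1 ⟨0, by omega⟩)
  simp [perm12] at h2

lemma swap_notMem_omegaStar (hn : 3 ≤ n) :
    swap (⟨0, by omega⟩ : Fin n) ⟨2, by omega⟩ ∉ OmegaStar n hn := by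
  intro h
  have h1 := (bijOn_apply_two hn).injOn h (perm123_mem hn)
    ((swap_apply_right _ _).trans (perm123_apply_two hn).symm)
  have h2 := congr($h1 ⟨1, by omega⟩)
  simp only [perm123, Perm.mul_apply, swap_apply_def] at h2
  grind

/-- The coset of permutations agreeing with `v` on all indices from `m` on. -/
def tailCoset (m : ℕ) (v : Perm (Fin n)) : Set (Perm (Fin n)) :=
  {u | ∀ k : Fin n, m ≤ (k : ℕ) → u k = v k}

/-- The coset splits into cosets of the next smaller level according to the value at index `m`. -/
lemma mem_tailCoset_of_succ {m : ℕ} (hm : m < n) {v a b : Perm (Fin n)}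
    (ha : a ∈ tailCoset (m + 1) v) (hb : b ∈ tailCoset (m + 1) v)
    (h : a ⟨m, hm⟩ = b ⟨m, hm⟩) : a ∈ tailCoset m b := by
  intro k hk
  obtain hk | hk := hk.eq_or_lt
  · obtain rfl : k = ⟨m, hm⟩ := Fin.ext hk.symm
    exact h
  · rw [ha k hk, hb k hk]

lemma tailCoset_subset_succ {m : ℕ} {v a : Perm (Fin n)} (ha : a ∈ tailCoset (m + 1) v) :
    tailCoset m a ⊆ tailCoset (m + 1) v :=
  fun _ hb k hk ↦ (hb k (by omega)).trans (ha k hk)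

lemma mul_mem_tailCoset {m : ℕ} {v a g : Perm (Fin n)} (ha : a ∈ tailCoset m v)
    (hg : ∀ k : Fin n, m ≤ (k : ℕ) → g k = k) : a * g ∈ tailCoset m v := by
  intro k hk
  rw [Perm.mul_apply, hg k hk, ha k hk]

lemma lt_of_apply_eq {m : ℕ} {v a b : Perm (Fin n)} (ha : a ∈ tailCoset m v)
    (hb : b ∈ tailCoset m v) {p q : Fin n} (hq : (q : ℕ) < m) (h : a p = b q) : (p : ℕ) < m := by
  by_contra! hp
  have : b p = b q := by rw [hb p hp, ← ha p hp, h]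
  rw [b.injective this] at hp
  omega

/-- Given two subcosets of level `m` in one coset of level `m + 1`, either some edge joining them
survives the deletion of `W`, or `W` meets every one of `m - 1` pairwise disjoint such edges. -/
lemma exists_cross_edge (hn : 3 ≤ n) {m : ℕ} (hm3 : 3 ≤ m) (hm : m < n) (W : Set (Perm (Fin n)))
    {v a b : Perm (Fin n)} (ha : a ∈ tailCoset (m + 1) v) (hb : b ∈ tailCoset (m + 1) v)
    (hab : a ⟨m, hm⟩ ≠ b ⟨m, hm⟩)
    (hW : {w ∈ W ∩ tailCoset (m + 1) v |
      s(w ⟨2, by omega⟩, w ⟨m, hm⟩) = s(a ⟨m, hm⟩, b ⟨m, hm⟩)}.ncard < m - 1) :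
    ∃ e ∈ tailCoset m a, ∃ f ∈ tailCoset m b, Joined hn W e f := by
  set M : Fin n := ⟨m, hm⟩ with hM
  set two : Fin n := ⟨2, by omega⟩ with htwo
  set zero : Fin n := ⟨0, by omega⟩
  obtain ⟨p, hp⟩ := a.surjective (b M)
  have hpm : (p : ℕ) < m := by
    have h1 := lt_of_apply_eq ha hb (show (M : ℕ) < m + 1 by simp [hM]) hp
    have h2 : p ≠ M := fun h ↦ hab (by rw [← hp, h])
    have h3 : (p : ℕ) ≠ m := fun h ↦ h2 (Fin.ext h)
    omega
  set e : Fin n → Perm (Fin n) := fun k ↦ a * swap two p * swap zero k with he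
  set g : Perm (Fin n) := perm12 n hn * swap two M with hg
  set K : Finset (Fin n) := Finset.univ.filter fun k ↦ (k : ℕ) < m ∧ k ≠ two with hK
  have hKcard : K.card = m - 1 := by
    have : K = (Finset.Iio M).erase two := by
      ext k
      simp [hK, hM, Fin.lt_def, and_comm]
    rw [this, Finset.card_erase_of_mem (by simp [hM, htwo, Fin.lt_def]; omega), Fin.card_Iio]
  have hmemK {k : Fin n} : k ∈ K ↔ (k : ℕ) < m ∧ k ≠ two := by simp [hK]
  have he_mem : ∀ k ∈ K, e k ∈ tailCoset m a := by
    intro k hk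
    rw [hmemK] at hk
    refine mul_mem_tailCoset (mul_mem_tailCoset (fun _ _ ↦ rfl) ?_) ?_ <;> intro l hl <;>
      exact swap_apply_of_ne_of_ne (by grind) (by grind)
  have he_two : ∀ k ∈ K, e k two = b M := by
    intro k hk
    rw [hmemK] at hk
    simp only [he, Perm.mul_apply]
    rw [swap_apply_of_ne_of_ne (by grind) (Ne.symm hk.2), swap_apply_left, hp]
  have he_M : ∀ k ∈ K, e k M = a M := fun k hk ↦ he_mem k hk M le_rfl
  have hf_M : ∀ k ∈ K, (e k * g) M = b M := by
    intro k hk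
    rw [Perm.mul_apply, hg, perm12_mul_swap_apply_right hn, ← htwo, he_two k hk]
  have hf_two : ∀ k ∈ K, (e k * g) two = a M := by
    intro k hk
    rw [Perm.mul_apply, hg, perm12_mul_swap_apply_two hn (by simp [hM]; omega), he_M k hk]
  have he_mem' : ∀ k ∈ K, e k ∈ tailCoset (m + 1) v :=
    fun k hk ↦ tailCoset_subset_succ ha (he_mem k hk)
  have hf_mem' : ∀ k ∈ K, e k * g ∈ tailCoset (m + 1) v := fun k hk ↦
    mul_mem_tailCoset (he_mem' k hk) fun l hl ↦
      perm12_mul_swap_apply_of_lt hn (by omega) (Fin.lt_def.2 (by simp [hM]; omega))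
  have he_inj : ∀ k l, e k = e l → k = l := by
    intro k l hkl
    have := congr($(mul_left_cancel hkl) zero)
    simpa using this
  suffices ∃ k ∈ K, e k ∉ W ∧ e k * g ∉ W by
    obtain ⟨k, hk, hek, hfk⟩ := this
    exact ⟨e k, he_mem k hk, e k * g, mem_tailCoset_of_succ hm (hf_mem' k hk) hb (hf_M k hk),
      .of_mem_omegaStar (perm12_mul_swap_mem hn hm3) hek hfk⟩
  by_contra! hcon
  refine hW.not_ge (hKcard ▸ card_le_ncard_of_forall_mem_or_mem K _ e (fun k ↦ e k * g)
    (fun k _ l _ ↦ he_inj k l) (fun k _ l _ h ↦ he_inj k l (mul_right_cancel h)) ?_ ?_)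
  · intro k hk l hl h
    apply hab
    rw [← he_M k hk, h, hf_M l hl]
  · intro k hk
    by_cases h : e k ∈ W
    · exact .inl ⟨⟨h, he_mem' k hk⟩, by rw [he_two k hk, he_M k hk, Sym2.eq_swap]⟩
    · exact .inr ⟨⟨hcon k hk h, hf_mem' k hk⟩, by rw [hf_two k hk, hf_M k hk]⟩

/-- Deleting fewer than `m` vertices from a coset of level `m` keeps its vertices joined. -/
def CosetsJoined (hn : 3 ≤ n) (m : ℕ) : Prop :=
  ∀ (W : Set (Perm (Fin n))) (v : Perm (Fin n)), (W ∩ tailCoset m v).ncard < m →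
    ∀ a ∈ tailCoset m v, ∀ b ∈ tailCoset m v, a ∉ W → b ∉ W → Joined hn W a b

lemma eq_or_eq_mul_perm12 (hn : 3 ≤ n) {u y : Perm (Fin n)} (h : u ∈ tailCoset 2 y) :
    u = y ∨ u = y * perm12 n hn := by
  have hlt {k : Fin n} (hk : (k : ℕ) < 2) : ((y⁻¹ * u) k : ℕ) < 2 :=
    lt_of_apply_eq (v := y) (fun _ _ ↦ rfl) h hk (by simp)
  have hfix {k : Fin n} (hk : 2 ≤ (k : ℕ)) : (y⁻¹ * u) k = k := by simp [h k hk]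
  have h01 : (y⁻¹ * u) ⟨0, by omega⟩ ≠ (y⁻¹ * u) ⟨1, by omega⟩ := fun h ↦ by
    simpa using (y⁻¹ * u).injective h
  have h0 := hlt (k := ⟨0, by omega⟩) (by simp)
  have h1 := hlt (k := ⟨1, by omega⟩) (by simp)
  rw [Ne, Fin.ext_iff] at h01
  rw [eq_comm, ← inv_mul_eq_one, ← inv_mul_eq_iff_eq_mul]
  have hcase (k : Fin n) : k = ⟨0, by omega⟩ ∨ k = ⟨1, by omega⟩ ∨ 2 ≤ (k : ℕ) := by grind
  by_cases hz : ((y⁻¹ * u) ⟨0, by omega⟩ : ℕ) = 0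
  · left
    ext k
    obtain rfl | rfl | hk := hcase k
    · simpa using hz
    · rw [Perm.one_apply]
      change _ = 1
      omega
    · rw [hfix hk, Perm.one_apply]
  · right
    ext k
    obtain rfl | rfl | hk := hcase k
    · rw [perm12, swap_apply_left]
      change _ = 1
      omega
    · rw [perm12, swap_apply_right]
      change _ = 0
      omega
    · rw [hfix hk, perm12_apply_of_two_le hn hk]

lemma cosetsJoined_three (hn : 3 ≤ n) : CosetsJoined hn 3 := by
  intro W v hW a ha b hb haW hbW
  set r := perm123 n hn
  set t := perm12 n hn
  set two : Fin n := ⟨2, by omega⟩ with htwo_def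
  have hrr : r * r = perm132 n hn := perm123_mul_self hn
  have hrrr : r * (r * r) = 1 := hrr ▸ perm123_mul_perm132 hn
  have htr : t * r = r * r * t := hrr ▸ perm12_mul_perm123 hn
  have htrr : t * (r * r) = r * t := hrr ▸ perm12_mul_perm132 hn
  have hrmem : r ∈ OmegaStar n hn := perm123_mem hn
  have hrrmem : r * r ∈ OmegaStar n hn := hrr ▸ perm132_mem hn
  have hrtwo : r two = ⟨0, by omega⟩ := perm123_apply_two hn
  have hrrtwo : (r * r) two = ⟨1, by omega⟩ := hrr ▸ perm132_apply_two hn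
  have httwo : t two = two := perm12_apply_of_two_le hn le_rfl
  have hrfix {k : Fin n} (hk : 3 ≤ (k : ℕ)) : r k = k := perm123_apply_of_three_le hn hk
  have htfix {k : Fin n} (hk : 3 ≤ (k : ℕ)) : t k = k := perm12_apply_of_two_le hn (by omega)
  set R : Finset (Perm (Fin n)) := {1, r, r * r} with hR
  have hdiff : ∀ g ∈ R, ∀ h ∈ R, ∃ s ∈ R, h = g * s := by
    have h1 : (1 : Perm (Fin n)) ∈ R := by simp [hR]
    have h2 : r ∈ R := by simp [hR]
    have h3 : r * r ∈ R := by simp [hR]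
    have h4 : r * r * (r * r) = r := by rw [mul_assoc, hrrr, mul_one]
    intro g hg h hh
    simp only [hR, Finset.mem_insert, Finset.mem_singleton] at hg hh
    rcases hg with rfl | rfl | rfl
    · exact ⟨h, by simpa [hR] using hh, (one_mul h).symm⟩
    · rcases hh with rfl | rfl | rfl
      exacts [⟨_, h3, hrrr.symm⟩, ⟨_, h1, (mul_one _).symm⟩, ⟨_, h2, rfl⟩]
    · rcases hh with rfl | rfl | rfl
      exacts [⟨_, h2, by rw [mul_assoc, hrrr]⟩, ⟨_, h3, h4.symm⟩, ⟨_, h1, (mul_one _).symm⟩]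
  have hcomm : ∀ s ∈ R, ∃ s' ∈ R, s * t = t * s' := by
    intro s hs
    simp only [hR, Finset.mem_insert, Finset.mem_singleton] at hs
    rcases hs with rfl | rfl | rfl
    exacts [⟨1, by simp [hR], by simp⟩, ⟨r * r, by simp [hR], htrr.symm⟩,
      ⟨r, by simp [hR], htr.symm⟩]
  have htR : t ∉ R := by
    have h0 : t ⟨0, by omega⟩ = ⟨1, by omega⟩ := swap_apply_left _ _
    simp only [hR, Finset.mem_insert, Finset.mem_singleton]
    rintro (h | h | h)
    · simp [h] at h0
    · rw [h, hrtwo] at httwo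
      simp [htwo_def] at httwo
    · rw [h, hrrtwo] at httwo
      simp [htwo_def] at httwo
  have hRcard : R.card = 3 := by
    refine Finset.card_eq_three.2 ⟨1, r, r * r, ?_, ?_, ?_, rfl⟩ <;> intro h <;>
      have h' := congr($h two)
    · rw [hrtwo] at h'
      simp [htwo_def] at h'
    · rw [hrrtwo] at h'
      simp [htwo_def] at h'
    · rw [hrrtwo, hrtwo] at h'
      simp at h'
  have hRjoin {x s : Perm (Fin n)} (hs : s ∈ R) (hx : x ∉ W) (hxs : x * s ∉ W) :
      Joined hn W x (x * s) := by
    simp only [hR, Finset.mem_insert, Finset.mem_singleton] at hs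
    rcases hs with rfl | rfl | rfl
    exacts [by simpa using Joined.refl hx, .of_mem_omegaStar hrmem hx hxs,
      .of_mem_omegaStar hrrmem hx hxs]
  have hRfix : ∀ g ∈ R, ∀ k : Fin n, 3 ≤ (k : ℕ) → g k = k := by
    intro g hg k hk
    simp only [hR, Finset.mem_insert, Finset.mem_singleton] at hg
    rcases hg with rfl | rfl | rfl <;> simp [hrfix hk]
  have hsurj : ∃ g ∈ R, (a * g) two = b two := by
    obtain ⟨p, hp⟩ := a.surjective (b two)
    have hp3 : (p : ℕ) < 3 := lt_of_apply_eq ha hb (by simp [htwo_def]) hp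
    obtain h | h | h : (p : ℕ) = 0 ∨ (p : ℕ) = 1 ∨ (p : ℕ) = 2 := by omega
    · refine ⟨r, by simp [hR], ?_⟩
      rw [← hp, Perm.mul_apply, hrtwo]
      exact congrArg a (Fin.ext h.symm)
    · refine ⟨r * r, by simp [hR], ?_⟩
      rw [← hp, Perm.mul_apply, hrrtwo]
      exact congrArg a (Fin.ext h.symm)
    · refine ⟨1, by simp [hR], ?_⟩
      rw [← hp, mul_one]
      exact congrArg a (Fin.ext h.symm)
  obtain ⟨g, hg, hgb⟩ := hsurj
  have hmem : ∀ h ∈ R, a * h ∈ tailCoset 3 v := fun h hh ↦ mul_mem_tailCoset ha (hRfix h hh)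
  rcases eq_or_eq_mul_perm12 hn (mem_tailCoset_of_succ (by omega) hb (hmem g hg) hgb.symm)
    with rfl | rfl
  · exact hRjoin hg haW hbW
  obtain ⟨h, hh, hh1, hh2⟩ : ∃ h ∈ R, a * h ∉ W ∧ a * h * t ∉ W := by
    by_contra! hcon
    refine hW.not_ge (hRcard.ge.trans (card_le_ncard_of_forall_mem_or_mem R _ (fun h ↦ a * h)
      (fun h ↦ a * h * t) (fun _ _ _ _ ↦ mul_left_cancel)
      (fun _ _ _ _ h ↦ mul_left_cancel (mul_right_cancel h)) ?_ ?_))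
    · intro k hk l hl hkl
      obtain ⟨s, hs, rfl⟩ := hdiff l hl k hk
      simp only [mul_assoc, mul_right_inj] at hkl
      exact htR (hkl ▸ hs)
    · intro k hk
      by_cases h : a * k ∈ W
      · exact .inl ⟨h, hmem k hk⟩
      · exact .inr ⟨hcon k hk h, mul_mem_tailCoset (hmem k hk) fun _ ↦ htfix⟩
  refine (hRjoin hh haW hh1).trans
    ((Joined.of_mem_omegaStar (perm12_mem hn) hh1 hh2).trans ?_)
  obtain ⟨s, hs, rfl⟩ := hdiff h hh g hg
  obtain ⟨s', hs', hss'⟩ := hcomm s hs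
  have heq : a * (h * s) * t = a * h * t * s' := by simp only [mul_assoc, hss']
  change a * (h * s) * t ∉ W at hbW
  change Joined hn W _ (a * (h * s) * t)
  rw [heq] at hbW ⊢
  exact hRjoin hs' hh2 hbW

/-- The inductive step when the deleted vertices are spread over several subcosets, so that each
subcoset stays joined. -/
lemma CosetsJoined.joined_of_forall_ncard_lt {hn : 3 ≤ n} {m : ℕ} (hm3 : 3 ≤ m) (hm : m < n)
    (ih : CosetsJoined hn m) {W : Set (Perm (Fin n))} {v a b : Perm (Fin n)}
    (hW : (W ∩ tailCoset (m + 1) v).ncard < m + 1)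
    (hsmall : ∀ x ∈ tailCoset (m + 1) v, (W ∩ tailCoset m x).ncard < m)
    (ha : a ∈ tailCoset (m + 1) v) (hb : b ∈ tailCoset (m + 1) v) (haW : a ∉ W) (hbW : b ∉ W) :
    Joined hn W a b := by
  set M : Fin n := ⟨m, hm⟩ with hM
  set two : Fin n := ⟨2, by omega⟩
  have hsame {x y : Perm (Fin n)} (hx : x ∈ tailCoset (m + 1) v)
      (hy : y ∈ tailCoset m x) {z : Perm (Fin n)} (hz : z ∈ tailCoset m x)
      (hyW : y ∉ W) (hzW : z ∉ W) : Joined hn W y z :=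
    ih W x (hsmall x hx) y hy z hz hyW hzW
  by_cases hab : a M = b M
  · exact hsame hb (mem_tailCoset_of_succ hm ha hb hab) (fun _ _ ↦ rfl) haW hbW
  set F : Sym2 (Fin n) → Set (Perm (Fin n)) := fun z ↦
    {w ∈ W ∩ tailCoset (m + 1) v | s(w two, w M) = z}
  have hcross {x y : Perm (Fin n)} (hx : x ∈ tailCoset (m + 1) v)
      (hy : y ∈ tailCoset (m + 1) v) (hxy : x M ≠ y M)
      (hlt : (F s(x M, y M)).ncard < m - 1) (hxW : x ∉ W) :
      ∃ f ∈ tailCoset m y, Joined hn W x f := by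
    obtain ⟨e, he, f, hf, hef⟩ := exists_cross_edge hn hm3 hm W hx hy hxy hlt
    exact ⟨f, hf, (hsame hx (fun _ _ ↦ rfl) he hxW hef.1).trans hef⟩
  have hdisj {z z' : Sym2 (Fin n)} (hz : z ≠ z') : (F z).ncard + (F z').ncard ≤ m := by
    rw [← Set.ncard_union_eq (Set.disjoint_left.2 fun w hw hw' ↦ hz (hw.2.symm.trans hw'.2))
      (Set.toFinite _) (Set.toFinite _)]
    refine (Set.ncard_le_ncard (Set.union_subset ?_ ?_) (Set.toFinite _)).trans
      (Nat.lt_succ_iff.1 hW) <;> exact fun w hw ↦ hw.1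
  by_cases hlt : (F s(a M, b M)).ncard < m - 1
  · obtain ⟨f, hf, haf⟩ := hcross ha hb hab hlt haW
    exact haf.trans (hsame hb hf (fun _ _ ↦ rfl) haf.2.1 hbW)
  · obtain ⟨q, hqm, hqb⟩ : ∃ q : Fin n, (q : ℕ) < m ∧ a q ≠ b M := by
      by_cases h : a ⟨0, by omega⟩ = b M
      · refine ⟨⟨1, by omega⟩, by simp; omega, fun h' ↦ ?_⟩
        simpa using a.injective (h.trans h'.symm)
      · exact ⟨⟨0, by omega⟩, by simp; omega, h⟩
    have hqM : q ≠ M := fun h ↦ by simp [h, hM] at hqm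
    have hc : a * swap M q ∈ tailCoset (m + 1) v :=
      mul_mem_tailCoset ha fun k hk ↦ swap_apply_of_ne_of_ne (by grind) (by grind)
    have hcM : (a * swap M q) M = a q := by simp
    have haq : a M ≠ a q := fun h ↦ hqM (a.injective h).symm
    have h1 := hdisj (z := s(a M, b M)) (z' := s(a M, a q))
      (by rwa [Ne, Sym2.congr_right, eq_comm])
    have h2 := hdisj (z := s(a M, b M)) (z' := s(a q, b M)) (by rwa [Ne, Sym2.congr_left])
    obtain ⟨f, hf, haf⟩ := hcross ha hc (by rwa [hcM]) (by rw [hcM]; omega) haW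
    have hfM : f M = a q := (hf M le_rfl).trans hcM
    obtain ⟨f', hf', hff'⟩ := hcross (tailCoset_subset_succ hc hf) hb (by rwa [hfM])
      (by rw [hfM]; omega) haf.2.1
    exact (haf.trans hff').trans (hsame hb hf' (fun _ _ ↦ rfl) hff'.2.1 hbW)

/-- The inductive step when all deleted vertices lie in one subcoset: its surviving vertices
escape to the other, undamaged, subcosets. -/
lemma CosetsJoined.joined_of_inter_eq {hn : 3 ≤ n} {m : ℕ} (hm3 : 3 ≤ m) (hm : m < n)
    (ih : CosetsJoined hn m) {W : Set (Perm (Fin n))} {v x a b : Perm (Fin n)}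
    (hsub : W ∩ tailCoset m x = W ∩ tailCoset (m + 1) v)
    (ha : a ∈ tailCoset (m + 1) v) (hb : b ∈ tailCoset (m + 1) v) (haW : a ∉ W) (hbW : b ∉ W) :
    Joined hn W a b := by
  set M : Fin n := ⟨m, hm⟩ with hM
  set two : Fin n := ⟨2, by omega⟩
  have hWx {w : Perm (Fin n)} (hw : w ∈ W) (hwv : w ∈ tailCoset (m + 1) v) : w M = x M :=
    (hsub.ge ⟨hw, hwv⟩).2 M le_rfl
  have hempty {y : Perm (Fin n)} (hy : y ∈ tailCoset (m + 1) v) (hyx : y M ≠ x M) :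
      (W ∩ tailCoset m y).ncard < m := by
    have : W ∩ tailCoset m y = ∅ := Set.eq_empty_of_forall_notMem fun w hw ↦
      hyx ((hw.2 M le_rfl).symm.trans (hWx hw.1 (tailCoset_subset_succ hy hw.2)))
    rw [this, Set.ncard_empty]
    omega
  have hout {y z : Perm (Fin n)} (hy : y ∈ tailCoset (m + 1) v)
      (hz : z ∈ tailCoset (m + 1) v) (hyx : y M ≠ x M) (hzx : z M ≠ x M)
      (hyW : y ∉ W) (hzW : z ∉ W) : Joined hn W y z := by
    by_cases hyz : y M = z M
    · exact ih W z (hempty hz hzx) y (mem_tailCoset_of_succ hm hy hz hyz) z (fun _ _ ↦ rfl)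
        hyW hzW
    obtain ⟨e, he, f, hf, hef⟩ := exists_cross_edge hn hm3 hm W hy hz hyz (by
      rw [Set.eq_empty_of_forall_notMem (s := {w ∈ _ | _}), Set.ncard_empty]
      · omega
      · rintro w ⟨⟨hw, hwv⟩, hw'⟩
        have hmem := Sym2.mem_mk_right (w two) (w M)
        rw [hw', hWx hw hwv, Sym2.mem_iff] at hmem
        exact hmem.elim hyx.symm hzx.symm)
    exact ((ih W y (hempty hy hyx) y (fun _ _ ↦ rfl) e he hyW hef.1).trans hef).trans
      (ih W z (hempty hz hzx) f hf z (fun _ _ ↦ rfl) hef.2.1 hzW)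
  have hescape {y : Perm (Fin n)} (hy : y ∈ tailCoset (m + 1) v) (hyW : y ∉ W) :
      ∃ z ∈ tailCoset (m + 1) v, z M ≠ x M ∧ Joined hn W y z := by
    by_cases hyx : y M = x M
    · set g := perm12 n hn * swap two M with hg
      have hz : y * g ∈ tailCoset (m + 1) v := mul_mem_tailCoset hy fun l hl ↦
        perm12_mul_swap_apply_of_lt hn (by omega) (Fin.lt_def.2 (by simp [hM]; omega))
      have hzM : (y * g) M ≠ x M := by
        rw [Perm.mul_apply, hg, perm12_mul_swap_apply_right hn, ← hyx]
        refine fun h ↦ ?_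
        have := congrArg Fin.val (y.injective h)
        simp only [hM] at this
        omega
      exact ⟨_, hz, hzM, .of_mem_omegaStar (perm12_mul_swap_mem hn hm3) hyW
        fun h ↦ hzM (hWx h hz)⟩
    · exact ⟨y, hy, hyx, .refl hyW⟩
  obtain ⟨a', ha', hax, haa'⟩ := hescape ha haW
  obtain ⟨b', hb', hbx, hbb'⟩ := hescape hb hbW
  exact (haa'.trans (hout ha' hb' hax hbx haa'.2.1 hbb'.2.1)).trans hbb'.symm

lemma CosetsJoined.succ {hn : 3 ≤ n} {m : ℕ} (hm3 : 3 ≤ m) (hm : m < n)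
    (ih : CosetsJoined hn m) : CosetsJoined hn (m + 1) := by
  intro W v hW a ha b hb haW hbW
  by_cases! hsmall : ∀ x ∈ tailCoset (m + 1) v, (W ∩ tailCoset m x).ncard < m
  · exact ih.joined_of_forall_ncard_lt hm3 hm hW hsmall ha hb haW hbW
  · obtain ⟨x, hx, hxm⟩ := hsmall
    exact ih.joined_of_inter_eq hm3 hm (Set.eq_of_subset_of_ncard_le
      (Set.inter_subset_inter_right _ (tailCoset_subset_succ hx)) (by omega) (Set.toFinite _))
      ha hb haW hbW

lemma cosetsJoined (hn : 3 ≤ n) {m : ℕ} (hm : 3 ≤ m) (hmn : m ≤ n) : CosetsJoined hn m := by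
  induction m, hm using Nat.le_induction with
  | base => exact cosetsJoined_three hn
  | succ m hm ih => exact (ih (by omega)).succ hm hmn

lemma joined_of_ncard_lt (hn : 3 ≤ n) {W : Set (Perm (Fin n))} (hW : W.ncard < n)
    {u v : Perm (Fin n)} (hu : u ∉ W) (hv : v ∉ W) : Joined hn W u v :=
  cosetsJoined hn hn le_rfl W 1
    ((Set.ncard_le_ncard Set.inter_subset_left W.toFinite).trans_lt hW)
    u (fun k hk ↦ absurd k.2 hk.not_gt) v (fun k hk ↦ absurd k.2 hk.not_gt) hu hv

/-- Deleting the neighbours of the identity isolates it. -/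
lemma not_preconnected_induce_compl_omegaStar (hn : 3 ≤ n) :
    ¬ ((godanGraph n hn).induce (OmegaStar n hn)ᶜ).Preconnected := by
  intro h
  have hne : (1 : Perm (Fin n)) ≠ swap ⟨0, by omega⟩ ⟨2, by omega⟩ := by
    rw [ne_comm, Ne, swap_eq_one_iff]
    simp
  obtain ⟨p⟩ := h ⟨1, one_notMem_omegaStar hn⟩ ⟨_, swap_notMem_omegaStar hn⟩
  generalize hy : (⟨swap _ _, _⟩ : ((OmegaStar n hn)ᶜ : Set (Perm (Fin n)))) = y at p
  cases p with
  | nil => exact hne (congrArg Subtype.val hy).symm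
  | @cons _ x _ hadj _ =>
    simp only [godanGraph, SimpleGraph.comap_adj, SimpleGraph.fromRel_adj,
      Function.Embedding.subtype_apply, one_mul] at hadj
    obtain ⟨-, ⟨s, hs, hxs⟩ | ⟨s, hs, hxs⟩⟩ := hadj
    · exact x.2 (eq_inv_of_mul_eq_one_left hxs.symm ▸ inv_mem_omegaStar hs)
    · exact x.2 (hxs ▸ hs)

end Connectivity

/-- For every n ≥ 3, the connectivity of EA_n equals n: deleting fewer than n
vertices always leaves a connected graph with at least two vertices, while some
set of n vertices disconnects EA_n. -/
theorem connectivity_godan (n : ℕ) (hn : 3 ≤ n) :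
    (∀ W : Set (Equiv.Perm (Fin n)), W.ncard < n →
      ((godanGraph n hn).induce Wᶜ).Connected ∧ 2 ≤ Wᶜ.ncard) ∧
    ∃ W : Set (Equiv.Perm (Fin n)), W.ncard = n ∧
      ¬ ((godanGraph n hn).induce Wᶜ).Preconnected := by
  refine ⟨fun W hW ↦ ⟨?_, ?_⟩, OmegaStar n hn, ncard_omegaStar hn,
    not_preconnected_induce_compl_omegaStar hn⟩
  · have hne : Wᶜ.Nonempty := by
      by_contra h
      rw [Set.not_nonempty_iff_eq_empty, Set.compl_empty_iff] at h
      rw [h, Set.ncard_univ, Nat.card_perm, Nat.card_fin] at hW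
      exact hW.not_ge n.self_le_factorial
    have := hne.to_subtype
    exact ⟨fun u v ↦ (joined_of_ncard_lt hn hW u.2 v.2).2.2⟩
  · have h := Set.ncard_add_ncard_compl W
    rw [Nat.card_perm, Nat.card_fin] at h
    have := Nat.lt_factorial_self hn
    omega

end Godan
end

section
/- Let G be a finite connected simple graph with minimum degree δ(G), and suppose G contains two adjacent vertices each of degree δ(G). Then for every integer k with 3 ≤ k ≤ |V(G)|, the generalized k-connectivity satisfies κ_k(G) ≤ δ(G) − 1. -/
namespace Godan

/-- A connected subgraph meeting both a set and its complement has an edge between them. -/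
theorem exists_adj_boundary {V : Type*} {G : SimpleGraph V} {H : G.Subgraph}
    (hH : H.coe.Connected) (A : Set V) {a b : V} (ha : a ∈ H.verts) (hb : b ∈ H.verts)
    (haA : a ∈ A) (hbA : b ∉ A) : ∃ x ∈ A, ∃ y ∉ A, H.Adj x y := by
  obtain ⟨p⟩ := hH.preconnected ⟨a, ha⟩ ⟨b, hb⟩
  obtain ⟨d, -, hd₁, hd₂⟩ := p.exists_boundary_dart (Subtype.val ⁻¹' A) haA hbA
  exact ⟨d.fst, hd₁, d.snd, hd₂, d.adj⟩

/-- Edge disjoint subgraphs in which `u` has a neighbor other than `v ∈ N(u)` number at most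
`deg u - 1`. -/
theorem card_le_degree_sub_one {V : Type*} [Fintype V] {G : SimpleGraph V}
    [DecidableRel G.Adj] {u v : V} (huv : G.Adj u v) {r : ℕ} (T : Fin r → G.Subgraph)
    (hT : ∀ i j, i ≠ j → (T i).edgeSet ∩ (T j).edgeSet = ∅)
    (hex : ∀ i, ∃ w, w ≠ v ∧ (T i).Adj u w) : r ≤ G.degree u - 1 := by
  classical
  choose f hfv hf using hex
  have hinj : Function.Injective f := by
    intro i j hij
    by_contra hne
    have hmem : s(u, f i) ∈ (T i).edgeSet ∩ (T j).edgeSet :=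
      ⟨hf i, by rw [hij]; exact hf j⟩
    simp [hT i j hne] at hmem
  have hsub : Finset.univ.image f ⊆ (G.neighborFinset u).erase v := by
    intro w hw
    obtain ⟨i, -, rfl⟩ := Finset.mem_image.mp hw
    simpa [hfv i] using (hf i).adj_sub
  have hcard := Finset.card_le_card hsub
  rwa [Finset.card_image_of_injective _ hinj, Finset.card_univ, Fintype.card_fin,
    Finset.card_erase_of_mem (by simpa using huv), G.card_neighborFinset_eq_degree] at hcard

/-- A family of internally edge disjoint `S`-trees, where `S` contains two adjacent vertices of
degree `d` and a third vertex, has at most `d - 1` members. -/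
theorem IsIDSTFamily.card_le {V : Type*} [Fintype V] {G : SimpleGraph V}
    [DecidableRel G.Adj] {u v w : V} {S : Set V} {d r : ℕ} {T : Fin r → G.Subgraph}
    (h : IsIDSTFamily G S T) (huv : G.Adj u v) (hu : G.degree u = d) (hv : G.degree v = d)
    (huS : u ∈ S) (hvS : v ∈ S) (hwS : w ∈ S) (hwu : w ≠ u) (hwv : w ≠ v) : r ≤ d - 1 := by
  have hdisj i j (hij : i ≠ j) := (h.2 i j hij).2
  have key {x y : V} (hxS : x ∈ S) (hyS : y ∈ S) (hxy : G.Adj x y) (i : Fin r)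
      (hi : ¬ (T i).Adj x y) : ∃ z, z ≠ y ∧ (T i).Adj x z := by
    obtain ⟨a, rfl, z, -, haz⟩ := exists_adj_boundary (h.1 i).2.1 {x}
      ((h.1 i).1 hxS) ((h.1 i).1 hyS) rfl (by simpa using hxy.ne')
    exact ⟨z, by rintro rfl; exact hi haz, haz⟩
  by_cases hi : ∃ i, (T i).Adj u v
  · obtain ⟨i, hi⟩ := hi
    have hother j (hj : j ≠ i) : ¬ (T j).Adj u v := by
      intro hadj
      have hmem : s(u, v) ∈ (T j).edgeSet ∩ (T i).edgeSet := ⟨hadj, hi⟩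
      simp [hdisj j i hj] at hmem
    obtain ⟨x, hx, z, hz, hxz⟩ := exists_adj_boundary (h.1 i).2.1 {u, v}
      ((h.1 i).1 huS) ((h.1 i).1 hwS) (by simp) (by simp [hwu, hwv])
    simp only [Set.mem_insert_iff, Set.mem_singleton_iff, not_or] at hx hz
    rcases hx with rfl | rfl
    · rw [← hu]
      refine card_le_degree_sub_one huv T hdisj fun j => ?_
      by_cases hj : j = i
      · exact ⟨z, hz.2, hj ▸ hxz⟩
      · exact key huS hvS huv j (hother j hj)
    · rw [← hv]
      refine card_le_degree_sub_one huv.symm T hdisj fun j => ?_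
      by_cases hj : j = i
      · exact ⟨z, hz.1, hj ▸ hxz⟩
      · exact key hvS huS huv.symm j fun hadj => hother j hj hadj.symm
  · rw [← hu]
    exact card_le_degree_sub_one huv T hdisj fun j =>
      key huS hvS huv j fun hadj => hi ⟨j, hadj⟩

/-- Let G be a finite connected simple graph with two adjacent vertices of
minimum degree. Then κ_k(G) ≤ δ(G) − 1 for every 3 ≤ k ≤ |V(G)|. -/
theorem genConn_le_minDegree_sub_one {V : Type*} [Fintype V] (G : SimpleGraph V)
    [DecidableRel G.Adj] (hconn : G.Connected) (u v : V) (huv : G.Adj u v)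
    (hu : G.degree u = G.minDegree) (hv : G.degree v = G.minDegree)
    (k : ℕ) (hk3 : 3 ≤ k) (hk : k ≤ Fintype.card V) :
    genConn G k ≤ G.minDegree - 1 := by
  classical
  obtain ⟨S, huvS, hS⟩ := Finset.exists_superset_card_eq (s := {u, v}) (n := k)
    (Finset.card_le_two.trans (by omega)) hk
  obtain ⟨w, hwS, hw⟩ := Finset.exists_mem_notMem_of_card_lt_card (s := {u, v}) (t := S)
    (Finset.card_le_two.trans_lt (by omega))
  simp only [Finset.mem_insert, Finset.mem_singleton, not_or] at hw
  have hmin : genConn G k ≤ maxIDST G (S : Set V) := Nat.sInf_le ⟨S, hS, rfl⟩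
  refine hmin.trans (csSup_le' ?_)
  rintro r ⟨T, hT⟩
  exact hT.card_le huv hu hv (huvS (by simp)) (huvS (by simp)) hwS hw.1 hw.2

end Godan
end

section
/- Let G be a finite r-regular simple graph and let k be an integer with 4 ≤ k ≤ |V(G)|. If the generalized k-connectivity satisfies κ_k(G) = r − 1, then the generalized (k−1)-connectivity satisfies κ_{k−1}(G) = r − 1. -/
namespace Godan

open SimpleGraph

section

variable {V : Type*} {G : SimpleGraph V} {S : Set V}

lemma IsIDSTFamily.sum_ncard_neighborSet_le [Fintype V] [DecidableRel G.Adj] {m : ℕ}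
    {T : Fin m → G.Subgraph} (hT : IsIDSTFamily G S T) (u : V) :
    ∑ i, ((T i).neighborSet u).ncard ≤ G.degree u := by
  classical
  let N : Fin m → Finset V := fun i => ((T i).neighborSet u).toFinite.toFinset
  have hN : ∀ i, ((T i).neighborSet u).ncard = (N i).card := fun i =>
    Set.ncard_eq_toFinset_card _ _
  simp only [hN]
  rw [← Finset.card_biUnion, ← card_neighborFinset_eq_degree]
  · refine Finset.card_le_card fun w hw => ?_
    obtain ⟨i, -, hi⟩ := Finset.mem_biUnion.1 hw
    have hi : (T i).Adj u w := by simpa [N] using hi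
    simpa using hi.adj_sub
  · intro i _ j _ hij
    refine Finset.disjoint_left.2 fun w hi hj => ?_
    have hi : (T i).Adj u w := by simpa [N] using hi
    have hj : (T j).Adj u w := by simpa [N] using hj
    have : s(u, w) ∈ (T i).edgeSet ∩ (T j).edgeSet := ⟨hi, hj⟩
    rw [(hT.2 i j hij).2] at this
    exact this

lemma exists_adj_of_isTree_coe {H : G.Subgraph} (hH : H.coe.IsTree) {u w : V}
    (hu : u ∈ H.verts) (hw : w ∈ H.verts) (huw : u ≠ w) : ∃ x, H.Adj u x := by
  obtain ⟨p⟩ := hH.1.preconnected ⟨u, hu⟩ ⟨w, hw⟩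
  cases p with
  | nil => exact absurd rfl huw
  | cons h _ => exact ⟨_, h⟩

lemma IsIDSTFamily.one_le_ncard_neighborSet [Finite V] {m : ℕ} {T : Fin m → G.Subgraph}
    (hT : IsIDSTFamily G S T) (hS : S.Nontrivial) {u : V} (hu : u ∈ S) (i : Fin m) :
    1 ≤ ((T i).neighborSet u).ncard := by
  obtain ⟨w, hw, hwu⟩ := hS.exists_ne u
  obtain ⟨x, hx⟩ := exists_adj_of_isTree_coe (hT.1 i).2 ((hT.1 i).1 hu) ((hT.1 i).1 hw) hwu.symm
  exact (Set.ncard_pos (Set.toFinite _)).2 ⟨x, hx⟩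

lemma IsIDSTFamily.le_degree [Fintype V] [DecidableRel G.Adj] {m : ℕ}
    {T : Fin m → G.Subgraph} (hT : IsIDSTFamily G S T) (hS : S.Nontrivial) {u : V}
    (hu : u ∈ S) : m ≤ G.degree u := by
  refine le_trans ?_ (hT.sum_ncard_neighborSet_le u)
  simpa using Finset.sum_le_sum fun i (_ : i ∈ Finset.univ) => hT.one_le_ncard_neighborSet hS hu i

lemma bddAbove_setOf_isIDSTFamily [Fintype V] (hS : S.Nontrivial) :
    BddAbove {m : ℕ | ∃ T : Fin m → G.Subgraph, IsIDSTFamily G S T} := by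
  classical
  obtain ⟨u, hu⟩ := hS.nonempty
  exact ⟨G.degree u, fun m ⟨_, hT⟩ => hT.le_degree hS hu⟩

lemma setOf_isIDSTFamily_nonempty :
    {m : ℕ | ∃ T : Fin m → G.Subgraph, IsIDSTFamily G S T}.Nonempty :=
  ⟨0, Fin.elim0, fun i => i.elim0, fun i => i.elim0⟩

lemma IsIDSTFamily.le_maxIDST [Fintype V] {m : ℕ} {T : Fin m → G.Subgraph}
    (hT : IsIDSTFamily G S T) (hS : S.Nontrivial) : m ≤ maxIDST G S :=
  le_csSup (bddAbove_setOf_isIDSTFamily hS) ⟨T, hT⟩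

lemma exists_isIDSTFamily_maxIDST [Fintype V] (hS : S.Nontrivial) :
    ∃ T : Fin (maxIDST G S) → G.Subgraph, IsIDSTFamily G S T :=
  Nat.sSup_mem setOf_isIDSTFamily_nonempty (bddAbove_setOf_isIDSTFamily hS)

lemma exists_isIDSTFamily_of_le_maxIDST [Fintype V] (hS : S.Nontrivial) {m : ℕ}
    (hm : m ≤ maxIDST G S) : ∃ T : Fin m → G.Subgraph, IsIDSTFamily G S T := by
  obtain ⟨T, hT⟩ := exists_isIDSTFamily_maxIDST (G := G) hS
  exact ⟨T ∘ Fin.castLE hm, fun i => hT.1 _,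
    fun i j hij => hT.2 _ _ fun h => hij (Fin.castLE_injective hm h)⟩

/-- Deleting a leaf from a tree leaves a tree. -/
lemma isTree_coe_deleteVerts_of_leaf {H : G.Subgraph} (hH : H.coe.IsTree) {v : V}
    (hv : v ∈ H.verts) (hleaf : (H.neighborSet v).ncard = 1) :
    (H.deleteVerts {v}).coe.IsTree := by
  classical
  obtain ⟨a, ha⟩ := Set.ncard_eq_one.1 hleaf
  have hadj : ∀ x, H.Adj v x ↔ x = a := fun x => by
    simpa using Set.ext_iff.1 ha x
  have hva : H.Adj v a := (hadj a).2 rfl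
  have hnb : H.coe.neighborSet ⟨v, hv⟩ = {⟨a, hva.snd_mem⟩} := by
    ext ⟨x, hx⟩
    simp [hadj]
  have : Fintype (H.coe.neighborSet ⟨v, hv⟩) := by
    rw [hnb]; infer_instance
  have hdeg : H.coe.degree ⟨v, hv⟩ = 1 := by
    rw [degree_eq_one_iff_existsUnique_adj]
    exact ⟨⟨a, hva.snd_mem⟩, hva, fun y hy => Subtype.ext ((hadj y).1 hy)⟩
  refine ⟨?_, ?_⟩
  · have hc := hH.1.induce_compl_singleton_of_degree_eq_one hdeg
    let f : H.coe.induce {(⟨v, hv⟩ : H.verts)}ᶜ →g (H.deleteVerts {v}).coe :=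
      { toFun := fun x => ⟨x.1.1, x.1.2, fun h => x.2 (Subtype.ext h)⟩
        map_rel' := fun {x y} hxy => by
          have hxy : H.Adj x.1.1 y.1.1 := hxy
          exact Subgraph.deleteVerts_adj.2 ⟨x.1.2, fun h => x.2 (Subtype.ext h), y.1.2,
            fun h => y.2 (Subtype.ext h), hxy⟩ }
    refine hc.map f fun y => ?_
    exact ⟨⟨⟨y.1, y.2.1⟩, fun h => y.2.2 (congrArg Subtype.val h)⟩, rfl⟩
  · exact hH.2.comap (Subgraph.inclusion Subgraph.deleteVerts_le)
      (Subgraph.inclusion.injective _)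

/-- In a tree with at least three vertices, two leaves are not adjacent. -/
lemma not_adj_of_leaves {H : G.Subgraph} (hH : H.coe.IsTree) {u v w : V}
    (hw : w ∈ H.verts) (hwu : w ≠ u) (hwv : w ≠ v)
    (hu : (H.neighborSet u).ncard = 1) (hv : (H.neighborSet v).ncard = 1) : ¬ H.Adj u v := by
  intro huv
  obtain ⟨a, ha⟩ := Set.ncard_eq_one.1 hu
  obtain ⟨b, hb⟩ := Set.ncard_eq_one.1 hv
  have hadju : ∀ x, H.Adj u x ↔ x = a := fun x => by simpa using Set.ext_iff.1 ha x
  have hadjv : ∀ x, H.Adj v x ↔ x = b := fun x => by simpa using Set.ext_iff.1 hb x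
  have hva := (hadju v).1 huv
  have hub := (hadjv u).1 huv.symm
  have key : ∀ x y : H.verts, H.coe.Walk x y → (x.1 = u ∨ x.1 = v) → (y.1 = u ∨ y.1 = v) := by
    intro x y p
    induction p with
    | nil => exact id
    | @cons x y z h p ih =>
      intro hx
      refine ih ?_
      have h : H.Adj x.1 y.1 := h
      rcases hx with hx | hx <;> rw [hx] at h
      · exact Or.inr (((hadju _).1 h).trans hva.symm)
      · exact Or.inl (((hadjv _).1 h).trans hub.symm)
  obtain ⟨p⟩ := hH.1.preconnected ⟨u, huv.fst_mem⟩ ⟨w, hw⟩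
  exact (key _ _ p (Or.inl rfl)).elim hwu hwv

lemma IsIDSTFamily.ncard_neighborSet_eq_one [Fintype V] [DecidableRel G.Adj] {m : ℕ}
    {T : Fin m → G.Subgraph} (hT : IsIDSTFamily G S T) (hS : S.Nontrivial) {u : V}
    (hu : u ∈ S) (hm : G.degree u ≤ m) (i : Fin m) : ((T i).neighborSet u).ncard = 1 := by
  have h1 := fun i => hT.one_le_ncard_neighborSet hS hu i
  have hsum : ∑ _i : Fin m, 1 = ∑ i, ((T i).neighborSet u).ncard := by
    refine le_antisymm (Finset.sum_le_sum fun i _ => h1 i) ?_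
    simpa using (hT.sum_ncard_neighborSet_le u).trans hm
  exact ((Finset.sum_eq_sum_iff_of_le fun i _ => h1 i).1 hsum i (Finset.mem_univ i)).symm

/-- Two adjacent vertices of degree at most `m` lying in `S` obstruct families of size `m`. -/
lemma IsIDSTFamily.false_of_adj [Fintype V] [DecidableRel G.Adj] {m : ℕ}
    {T : Fin m → G.Subgraph} (hT : IsIDSTFamily G S T) {u v w : V} (hu : u ∈ S) (hv : v ∈ S)
    (hw : w ∈ S) (hwu : w ≠ u) (hwv : w ≠ v) (huv : G.Adj u v)
    (hmu : G.degree u ≤ m) (hmv : G.degree v ≤ m) : False := by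
  classical
  have hS : S.Nontrivial := ⟨u, hu, v, hv, huv.ne⟩
  have hleafu := hT.ncard_neighborSet_eq_one hS hu hmu
  have hleafv := hT.ncard_neighborSet_eq_one hS hv hmv
  have hnot : ∀ i, ¬ (T i).Adj u v := fun i =>
    not_adj_of_leaves (hT.1 i).2 ((hT.1 i).1 hw) hwu hwv (hleafu i) (hleafv i)
  have hsub : IsIDSTFamily (G.deleteEdges {s(u, v)}) S fun i =>
      { verts := (T i).verts
        Adj := (T i).Adj
        adj_sub := fun {x y} h => by
          rw [deleteEdges_adj]
          refine ⟨h.adj_sub, fun he => hnot i ?_⟩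
          rw [← Subgraph.mem_edgeSet] at h ⊢
          rwa [← Set.mem_singleton_iff.1 he]
        edge_vert := (T i).edge_vert
        symm := (T i).symm } := ⟨fun i => hT.1 i, fun i j hij => hT.2 i j hij⟩
  have hlt : (G.deleteEdges {s(u, v)}).degree u < G.degree u := by
    rw [← card_neighborFinset_eq_degree, ← card_neighborFinset_eq_degree]
    refine Finset.card_lt_card ((Finset.ssubset_iff_of_subset fun x hx => ?_).2 ⟨v, ?_, ?_⟩)
    · rw [mem_neighborFinset, deleteEdges_adj] at hx
      exact (mem_neighborFinset _ _ _).2 hx.1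
    · exact (mem_neighborFinset _ _ _).2 huv
    · simp
  have := hsub.le_degree hS hu
  omega

/-- If `v` has degree at most `m + 1`, then `v` may be dropped from the terminal set. -/
lemma IsIDSTFamily.exists_of_insert [Fintype V] [DecidableRel G.Adj] {m : ℕ} {v : V}
    (hv : v ∉ S) {T : Fin m → G.Subgraph} (hT : IsIDSTFamily G (insert v S) T)
    (hS : S.Nonempty) (hm : G.degree v ≤ m + 1) :
    ∃ T' : Fin m → G.Subgraph, IsIDSTFamily G S T' := by
  classical
  have hS' : (insert v S).Nontrivial := by
    obtain ⟨x, hx⟩ := hS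
    exact ⟨v, Set.mem_insert _ _, x, Set.mem_insert_of_mem _ hx, fun h => hv (h ▸ hx)⟩
  have hvS : v ∈ insert v S := Set.mem_insert _ _
  have h1 := fun i => hT.one_le_ncard_neighborSet hS' hvS i
  have huniq : ∀ i j, i ≠ j → ((T i).neighborSet v).ncard = 1 ∨
      ((T j).neighborSet v).ncard = 1 := by
    intro i j hij
    by_contra! hc
    have hi := h1 i
    have hj := h1 j
    have hle : ∑ l : Fin m, (1 + (if l = i then 1 else 0) + (if l = j then 1 else 0)) ≤
        ∑ l, ((T l).neighborSet v).ncard := by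
      refine Finset.sum_le_sum fun l _ => ?_
      have hl := h1 l
      by_cases hli : l = i
      · subst hli
        simp [hij]
        omega
      · by_cases hlj : l = j
        · subst hlj
          simp [hli]
          omega
        · simpa [hli, hlj] using hl
    have := hT.sum_ncard_neighborSet_le v
    simp [Finset.sum_add_distrib] at hle
    omega
  let T' : Fin m → G.Subgraph := fun i =>
    if ((T i).neighborSet v).ncard = 1 then (T i).deleteVerts {v} else T i
  have hpos : ∀ i, ((T i).neighborSet v).ncard = 1 → T' i = (T i).deleteVerts {v} :=
    fun i h => if_pos h
  have hneg : ∀ i, ((T i).neighborSet v).ncard ≠ 1 → T' i = T i := fun i h => if_neg h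
  have hle : ∀ i, T' i ≤ T i := fun i => by
    by_cases h : ((T i).neighborSet v).ncard = 1
    · exact hpos i h ▸ Subgraph.deleteVerts_le
    · exact (hneg i h).le
  have hmem : ∀ i, ((T i).neighborSet v).ncard = 1 → v ∉ (T' i).verts := fun i h => by
    simp [hpos i h]
  have hsub : ∀ i, S ⊆ (T' i).verts := fun i x hx => by
    have hxT := (hT.1 i).1 (Set.mem_insert_of_mem v hx)
    by_cases h : ((T i).neighborSet v).ncard = 1
    · rw [hpos i h]
      exact ⟨hxT, fun hxv => hv (Set.mem_singleton_iff.1 hxv ▸ hx)⟩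
    · rwa [hneg i h]
  refine ⟨T', fun i => ⟨hsub i, ?_⟩, fun i j hij => ⟨?_, ?_⟩⟩
  · by_cases h : ((T i).neighborSet v).ncard = 1
    · rw [hpos i h]
      exact isTree_coe_deleteVerts_of_leaf (hT.1 i).2 ((hT.1 i).1 hvS) h
    · rw [hneg i h]
      exact (hT.1 i).2
  · refine Set.Subset.antisymm (fun x hx => ?_) fun x hx => ⟨hsub i hx, hsub j hx⟩
    have hx' : x ∈ insert v S := by
      rw [← (hT.2 i j hij).1]
      exact ⟨(hle i).1 hx.1, (hle j).1 hx.2⟩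
    refine hx'.resolve_left fun hxv => ?_
    rw [hxv] at hx
    exact (huniq i j hij).elim (fun h => hmem i h hx.1) fun h => hmem j h hx.2
  · rw [← Set.subset_empty_iff, ← (hT.2 i j hij).2]
    exact Set.inter_subset_inter (Subgraph.edgeSet_mono (hle i)) (Subgraph.edgeSet_mono (hle j))

end

/-- Let G be a finite r-regular simple graph and 4 ≤ k ≤ |V(G)|. If
κ_k(G) = r − 1 then κ_{k−1}(G) = r − 1. -/
theorem genConn_pred {V : Type*} [Fintype V] (G : SimpleGraph V)
    [DecidableRel G.Adj] (r : ℕ) (hreg : ∀ v : V, G.degree v = r)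
    (k : ℕ) (hk4 : 4 ≤ k) (hk : k ≤ Fintype.card V)
    (h : genConn G k = r - 1) :
    genConn G (k - 1) = r - 1 := by
  classical
  have hnt : ∀ S : Finset V, 2 ≤ S.card → (S : Set V).Nontrivial := fun S hS =>
    Finset.one_lt_card_iff_nontrivial.1 hS
  have hlower : ∀ S : Finset V, S.card = k - 1 → r - 1 ≤ maxIDST G (S : Set V) := by
    intro S hS
    obtain ⟨v, hv⟩ : ∃ v, v ∉ S := by
      by_contra! hall
      have := Finset.card_univ (α := V)
      rw [← Finset.eq_univ_iff_forall.2 hall] at this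
      omega
    have hcard : (insert v S).card = k := by
      rw [Finset.card_insert_of_notMem hv]
      omega
    have hle : r - 1 ≤ maxIDST G ((insert v S : Finset V) : Set V) :=
      h ▸ Nat.sInf_le ⟨insert v S, hcard, rfl⟩
    obtain ⟨T, hT⟩ := exists_isIDSTFamily_of_le_maxIDST (hnt _ (by omega)) hle
    rw [Finset.coe_insert] at hT
    have hSnt := hnt S (by omega)
    obtain ⟨T', hT'⟩ := hT.exists_of_insert (by simpa using hv) hSnt.nonempty
      (by rw [hreg]; omega)
    exact hT'.le_maxIDST hSnt
  obtain ⟨S, hS, hupper⟩ : ∃ S : Finset V, S.card = k - 1 ∧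
      maxIDST G (S : Set V) ≤ r - 1 := by
    by_cases hE : ∃ u v, G.Adj u v
    · obtain ⟨u, v, huv⟩ := hE
      obtain ⟨S, hsub, -, hS⟩ := Finset.exists_subsuperset_card_eq
        (Finset.subset_univ ({u, v} : Finset V)) (n := k - 1)
        (by rw [Finset.card_pair huv.ne]; omega) (by rw [Finset.card_univ]; omega)
      refine ⟨S, hS, ?_⟩
      obtain ⟨w, hw, hwuv⟩ := Finset.exists_mem_notMem_of_card_lt_card
        (show ({u, v} : Finset V).card < S.card by rw [Finset.card_pair huv.ne]; omega)
      simp only [Finset.mem_insert, Finset.mem_singleton, not_or] at hwuv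
      by_contra! hlt
      obtain ⟨T, hT⟩ := exists_isIDSTFamily_of_le_maxIDST (hnt S (by omega))
        (show r ≤ maxIDST G (S : Set V) by omega)
      exact hT.false_of_adj (hsub (by simp)) (hsub (by simp)) hw hwuv.1 hwuv.2 huv
        (hreg u).le (hreg v).le
    · obtain ⟨S, -, hS⟩ := Finset.exists_subset_card_eq
        (show k - 1 ≤ (Finset.univ : Finset V).card by rw [Finset.card_univ]; omega)
      refine ⟨S, hS, ?_⟩
      have hSnt := hnt S (by omega)
      obtain ⟨T, hT⟩ := exists_isIDSTFamily_maxIDST (G := G) hSnt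
      obtain ⟨u, hu⟩ := hSnt.nonempty
      have hle := hT.le_degree hSnt hu
      have hzero : G.degree u = 0 := by
        rw [← card_neighborFinset_eq_degree, Finset.card_eq_zero,
          Finset.eq_empty_iff_forall_notMem]
        exact fun x hx => hE ⟨u, x, (mem_neighborFinset _ _ _).1 hx⟩
      omega
  refine le_antisymm (le_trans (Nat.sInf_le ⟨S, hS, rfl⟩) hupper) ?_
  refine le_csInf ⟨_, S, hS, rfl⟩ ?_
  rintro _ ⟨S', hS', rfl⟩
  exact hlower S' hS'

end Godan
end
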